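/- arXiv:0707.3545 — 9 statements merged into one kernel-verified Lean document; each statement's English description precedes it below -/
import Mathlib

section
/- Let π_n be Borel probability measures on [0,1], let θ̃_n have law π_n and set T_n := n·θ̃_n. Suppose T_n converges in distribution to a random variable T with distribution function F. Then for every fixed integer k ≥ 0, the out-degree probabilities converge to a mixed Poisson law: lim_{n→∞} C(n,k) ∫_{[0,1]} θ^k (1−θ)^{n−k} π_n(dθ) = E[T^k e^{−T}/k!] = ∫_0^∞ (t^k/k!) e^{−t} dF(t). -/
open MeasureTheory Filter Topology

/-- The binomial weight is at most a constant times the Poisson weight with the same mean. -/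
lemma choose_mul_pow_mul_one_sub_pow_le {n k : ℕ} (hkn : k ≤ n) {p : ℝ} (h0 : 0 ≤ p) (h1 : p ≤ 1) :
    (n.choose k : ℝ) * p ^ k * (1 - p) ^ (n - k)
      ≤ Real.exp k * (((n : ℝ) * p) ^ k * Real.exp (-((n : ℝ) * p)) / k.factorial) := by
  have hexp : (1 - p) ^ (n - k) ≤ Real.exp k * Real.exp (-((n : ℝ) * p)) := by
    calc (1 - p) ^ (n - k) ≤ Real.exp (-p) ^ (n - k) :=
          pow_le_pow_left₀ (by linarith) (Real.one_sub_le_exp_neg p) _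
      _ = Real.exp (k * p - n * p) := by
          rw [← Real.exp_nat_mul, Nat.cast_sub hkn]; ring_nf
      _ ≤ Real.exp (k - n * p) := by
          gcongr
          exact mul_le_of_le_one_right (Nat.cast_nonneg k) h1
      _ = _ := by rw [← Real.exp_add]; ring_nf
  calc (n.choose k : ℝ) * p ^ k * (1 - p) ^ (n - k)
      ≤ ((n : ℝ) ^ k / k.factorial) * p ^ k * (Real.exp k * Real.exp (-((n : ℝ) * p))) := by
        gcongr
        exact Nat.choose_le_pow_div k n
    _ = _ := by rw [mul_pow]; ring

/-- The Poisson limit theorem along a subsequence. -/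
lemma tendsto_choose_mul_pow_comp_of_strictMono (k : ℕ) {p : ℕ → ℝ} {φ : ℕ → ℕ}
    (hφ : StrictMono φ) {r : ℝ}
    (hr : Tendsto (fun m => (φ m : ℝ) * p (φ m)) atTop (𝓝 r)) :
    Tendsto (fun m => ((φ m).choose k : ℝ) * p (φ m) ^ k * (1 - p (φ m)) ^ (φ m - k)) atTop
      (𝓝 (r ^ k * Real.exp (-r) / k.factorial)) := by
  classical
  set q : ℕ → ℝ := fun n => if n ∈ Set.range φ then p n else r / n with hq
  have hq' : Tendsto (fun n : ℕ => (n : ℝ) * q n) atTop (𝓝 r) := by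
    rw [tendsto_def] at hr ⊢
    intro s hs
    obtain ⟨M, hM⟩ := mem_atTop_sets.1 (hr s hs)
    filter_upwards [eventually_ge_atTop (φ M), eventually_gt_atTop 0] with n hn hn0
    by_cases h : n ∈ Set.range φ
    · obtain ⟨m, rfl⟩ := h
      simpa [hq] using hM m (hφ.le_iff_le.1 hn)
    · have hn0' : (n : ℝ) ≠ 0 := by positivity
      have hqn : (n : ℝ) * q n = r := by
        simp only [hq, if_neg h]
        exact mul_div_cancel₀ r hn0'
      simpa only [Set.mem_preimage, hqn] using mem_of_mem_nhds hs
  have := (ProbabilityTheory.tendsto_choose_mul_pow_of_tendsto_mul_atTop k hq').comp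
    hφ.tendsto_atTop
  rw [mul_comm (r ^ k)]
  refine this.congr fun m => ?_
  simp [hq]

/-- Binomial and Poisson weights with equal means are asymptotically equal, with no assumption on
the success probabilities. -/
lemma tendsto_choose_mul_pow_sub_poisson (k : ℕ) {p : ℕ → ℝ} (hp : ∀ n, p n ∈ Set.Icc (0 : ℝ) 1) :
    Tendsto (fun n : ℕ => (n.choose k : ℝ) * p n ^ k * (1 - p n) ^ (n - k)
      - ((n : ℝ) * p n) ^ k * Real.exp (-((n : ℝ) * p n)) / k.factorial) atTop (𝓝 0) := by
  refine tendsto_of_subseq_tendsto fun ns hns => ?_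
  obtain ⟨ms, -, hφ⟩ := strictMono_subseq_of_tendsto_atTop hns
  have hcont : Continuous fun t : ℝ => t ^ k * Real.exp (-t) / (k.factorial : ℝ) := by fun_prop
  by_cases h : Tendsto (fun m => (ns (ms m) : ℝ) * p (ns (ms m))) atTop atTop
  · refine ⟨ms, ?_⟩
    have hpois : Tendsto (fun t : ℝ => t ^ k * Real.exp (-t) / (k.factorial : ℝ)) atTop (𝓝 0) := by
      simpa using (Real.tendsto_pow_mul_exp_neg_atTop_nhds_zero k).div_const (k.factorial : ℝ)
    have h₁ := hpois.comp h
    have h₂ : Tendsto (fun m => ((ns (ms m)).choose k : ℝ) * p (ns (ms m)) ^ k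
        * (1 - p (ns (ms m))) ^ (ns (ms m) - k)) atTop (𝓝 0) := by
      refine squeeze_zero' (.of_forall fun m => ?_) ?_ (by simpa using h₁.const_mul (Real.exp k))
      · have := (hp (ns (ms m))).1
        have := sub_nonneg.2 (hp (ns (ms m))).2
        positivity
      · filter_upwards [hφ.tendsto_atTop.eventually_ge_atTop k] with m hm
        exact choose_mul_pow_mul_one_sub_pow_le hm (hp _).1 (hp _).2
    simpa using h₂.sub h₁
  · simp only [tendsto_atTop, not_forall, not_eventually, not_le] at h
    obtain ⟨M, hM⟩ := h
    have hfreq : ∃ᶠ m in atTop, (ns (ms m) : ℝ) * p (ns (ms m)) ∈ Set.Icc 0 M :=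
      hM.mono fun m hm => ⟨mul_nonneg (Nat.cast_nonneg _) (hp _).1, hm.le⟩
    obtain ⟨r, -, ψ, hψ, hr⟩ := isCompact_Icc.tendsto_subseq' hfreq
    refine ⟨ms ∘ ψ, ?_⟩
    have h₁ := tendsto_choose_mul_pow_comp_of_strictMono k (hφ.comp hψ) hr
    have h₂ := (hcont.tendsto r).comp hr
    simpa using h₁.sub h₂

/-- The Poisson weight `t ↦ t ^ k * exp (-t) / k!`, extended to negative `t` by its value at `0`. -/
noncomputable def poissonWeight (k : ℕ) : BoundedContinuousFunction ℝ ℝ :=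
  BoundedContinuousFunction.ofNormedAddCommGroup
    (fun t => (max t 0) ^ k * Real.exp (-(max t 0)) / (k.factorial : ℝ)) (by fun_prop) 1
    (fun t => by
      have ht : 0 ≤ max t 0 := le_max_right _ _
      rw [Real.norm_of_nonneg (by positivity), mul_div_right_comm, Real.exp_neg, ← div_eq_mul_inv]
      exact div_le_one_of_le₀ (Real.pow_div_factorial_le_exp _ ht k) (Real.exp_pos _).le)

lemma poissonWeight_of_nonneg (k : ℕ) {t : ℝ} (ht : 0 ≤ t) :
    poissonWeight k t = t ^ k * Real.exp (-t) / (k.factorial : ℝ) := by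
  simp [poissonWeight, max_eq_left ht]

/-- If `T_n = n·θ̃_n` (with `θ̃_n ~ π_n`) converges in distribution to `T`
(with law `μ`), then the out-degree probabilities converge to a mixed Poisson law. -/
theorem outdegree_tendsto_mixed_poisson
    (π : ℕ → Measure ℝ) (hprob : ∀ n, IsProbabilityMeasure (π n))
    (hsupp : ∀ n, π n (Set.Icc (0 : ℝ) 1) = 1)
    (μ : Measure ℝ) (hμprob : IsProbabilityMeasure μ)
    (hμsupp : μ (Set.Iio (0 : ℝ)) = 0)
    (hconv : ∀ f : BoundedContinuousFunction ℝ ℝ,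
      Tendsto (fun n : ℕ => ∫ θ, f ((n : ℝ) * θ) ∂(π n)) atTop
        (𝓝 (∫ t, f t ∂μ)))
    (k : ℕ) :
    Tendsto
      (fun n : ℕ => (n.choose k : ℝ) * ∫ θ, θ ^ k * (1 - θ) ^ (n - k) ∂(π n))
      atTop
      (𝓝 (∫ t, t ^ k * Real.exp (-t) / (k.factorial : ℝ) ∂μ)) := by
  have hμ : ∫ t, poissonWeight k t ∂μ = ∫ t, t ^ k * Real.exp (-t) / (k.factorial : ℝ) ∂μ := by
    refine integral_congr_ae ?_
    have : ∀ᵐ t ∂μ, t ∉ Set.Iio (0 : ℝ) := measure_eq_zero_iff_ae_notMem.1 hμsupp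
    filter_upwards [this] with t ht
    exact poissonWeight_of_nonneg k (not_lt.1 ht)
  have hae : ∀ n, ∀ᵐ θ ∂(π n), θ ∈ Set.Icc (0 : ℝ) 1 := fun n =>
    (prob_compl_eq_zero_iff measurableSet_Icc).2 (hsupp n)
  rw [← hμ]
  set D : ℕ → ℝ → ℝ := fun n θ =>
    (n.choose k : ℝ) * (θ ^ k * (1 - θ) ^ (n - k)) - poissonWeight k (n * θ) with hD
  have hDcont : ∀ n, Continuous (D n) := fun n => by fun_prop
  have hmax : ∀ n, ∃ p ∈ Set.Icc (0 : ℝ) 1, IsMaxOn (fun θ => ‖D n θ‖) (Set.Icc 0 1) p :=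
    fun n => isCompact_Icc.exists_isMaxOn ⟨0, by simp⟩ (hDcont n).norm.continuousOn
  choose p hp hpmax using hmax
  have hDp : Tendsto (fun n => D n (p n)) atTop (𝓝 0) := by
    refine (tendsto_choose_mul_pow_sub_poisson k hp).congr fun n => ?_
    simp only [hD]
    rw [poissonWeight_of_nonneg k (mul_nonneg (Nat.cast_nonneg n) (hp n).1), mul_assoc]
  have hint : Tendsto (fun n => ∫ θ, D n θ ∂(π n)) atTop (𝓝 0) := by
    refine squeeze_zero_norm (fun n => ?_) (tendsto_zero_iff_norm_tendsto_zero.1 hDp)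
    have := norm_integral_le_of_norm_le_const (μ := π n) (C := ‖D n (p n)‖)
      ((hae n).mono fun θ hθ => hpmax n hθ)
    simpa using this
  have hsum := hint.add (hconv (poissonWeight k))
  rw [zero_add] at hsum
  refine hsum.congr fun n => ?_
  have hI : ∀ f : ℝ → ℝ, Continuous f → Integrable f (π n) := fun f hf => by
    rw [← Measure.restrict_eq_self_of_ae_mem (hae n)]
    exact hf.continuousOn.integrableOn_compact isCompact_Icc
  rw [← integral_add (hI _ (hDcont n)) (hI _ (by fun_prop)), ← integral_const_mul]
  simp [hD]
end

section
/- Fix α > 0 and β > 1, and define p_{α,β}(k) := (α^{β−1}(β−1)/k!) ∫_α^∞ t^{k−β} e^{−t} dt for integers k ≥ 0. Then p_{α,β} has a power-law tail with exponent β: p_{α,β}(k) = α^{β−1}(β−1) k^{−β} (1 + o(1)) as k → ∞, i.e. lim_{k→∞} k^β p_{α,β}(k) = α^{β−1}(β−1). -/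
open MeasureTheory Filter Topology

lemma Real.Gamma_add_natCast_add_one {s : ℝ} (hs : 0 < s) (n : ℕ) :
    Real.Gamma (s + n + 1) = Real.Gamma s * ∏ j ∈ Finset.range (n + 1), (s + j) := by
  induction n with
  | zero => simp [Real.Gamma_add_one hs.ne', mul_comm]
  | succ n ih =>
    have h : s + (n : ℝ) + 1 ≠ 0 := by positivity
    rw [Finset.prod_range_succ, ← mul_assoc, ← ih]
    push_cast
    rw [← add_assoc s, Real.Gamma_add_one h, mul_comm]

/-- For `s > 0`, `Γ(n + 1 + s) ∼ n ^ s * n!`. -/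
lemma Real.tendsto_Gamma_add_div_of_pos {s : ℝ} (hs : 0 < s) :
    Tendsto (fun n : ℕ => Real.Gamma (n + 1 + s) / ((n : ℝ) ^ s * n.factorial)) atTop (𝓝 1) := by
  have hΓ := (Real.Gamma_pos_of_pos hs).ne'
  have h := (tendsto_const_nhds (x := Real.Gamma s)).div (Real.GammaSeq_tendsto_Gamma s) hΓ
  rw [div_self hΓ] at h
  refine h.congr fun n => ?_
  rw [show (n : ℝ) + 1 + s = s + n + 1 by ring, Real.Gamma_add_natCast_add_one hs]
  simp only [Pi.div_apply, Real.GammaSeq]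
  rw [div_div_eq_mul_div]

lemma Real.tendsto_Gamma_add_div (s : ℝ) :
    Tendsto (fun n : ℕ => Real.Gamma (n + 1 + s) / ((n : ℝ) ^ s * n.factorial)) atTop (𝓝 1) := by
  obtain ⟨m, hm⟩ := exists_nat_gt (-s)
  induction m generalizing s with
  | zero => exact Real.tendsto_Gamma_add_div_of_pos (by simpa using hm)
  | succ m ih =>
    have h := ih (s + 1) (by push_cast at hm; linarith)
    have h' : Tendsto (fun n : ℕ => (n : ℝ) / (n + (1 + s))) atTop (𝓝 1) :=
      tendsto_natCast_div_add_atTop (1 + s)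
    have hmul := h.mul h'
    rw [one_mul] at hmul
    refine hmul.congr' ?_
    filter_upwards [tendsto_natCast_atTop_atTop.eventually_gt_atTop (-(1 + s)),
      eventually_gt_atTop 0] with n hn hn0
    have hn0' : (0 : ℝ) < n := by exact_mod_cast hn0
    have hpos : (0 : ℝ) < n + 1 + s := by linarith
    have hf : (n.factorial : ℝ) ≠ 0 := by positivity
    have hp : (n : ℝ) ^ s ≠ 0 := by positivity
    rw [← add_assoc, Real.Gamma_add_one hpos.ne', Real.rpow_add_one hn0'.ne', ← add_assoc]
    field_simp

lemma tendsto_rpow_mul_pow_div_factorial (β c : ℝ) :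
    Tendsto (fun n : ℕ => (n : ℝ) ^ β * (c ^ n / n.factorial)) atTop (𝓝 0) := by
  refine squeeze_zero_norm' ?_ (FloorSemiring.tendsto_pow_div_factorial_atTop (Real.exp 1 * |c|))
  have h := ((isLittleO_rpow_exp_atTop β).comp_tendsto
    (tendsto_natCast_atTop_atTop (R := ℝ))).bound one_pos
  filter_upwards [h] with n hn
  simp only [Function.comp_apply, one_mul, Real.norm_eq_abs, Real.abs_exp] at hn
  rw [norm_mul, norm_div, norm_pow, mul_pow, ← Real.exp_nat_mul, mul_one, mul_div_assoc]
  simp only [Real.norm_eq_abs, Nat.abs_cast]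
  gcongr

/-- The upper incomplete gamma integral differs from `Γ` by at most `α ^ s * α`. -/
lemma abs_Gamma_sub_setIntegral_Ioi_le {α s : ℝ} (hα : 0 < α) (hs : 0 ≤ s) :
    |Real.Gamma (s + 1) - ∫ t in Set.Ioi α, t ^ s * Real.exp (-t)| ≤ α ^ s * α := by
  have hint : IntegrableOn (fun t : ℝ => t ^ s * Real.exp (-t)) (Set.Ioi 0) := by
    simpa [mul_comm] using Real.GammaIntegral_convergent (s := s + 1) (by linarith)
  have hG : Real.Gamma (s + 1) = ∫ t in Set.Ioi (0 : ℝ), t ^ s * Real.exp (-t) := by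
    simp [Real.Gamma_eq_integral (show 0 < s + 1 by linarith), mul_comm]
  have hsplit : ∫ t in Set.Ioi (0 : ℝ), t ^ s * Real.exp (-t) =
      (∫ t in Set.Ioc 0 α, t ^ s * Real.exp (-t)) + ∫ t in Set.Ioi α, t ^ s * Real.exp (-t) := by
    rw [← Set.Ioc_union_Ioi_eq_Ioi hα.le]
    exact setIntegral_union (Set.Ioc_disjoint_Ioi le_rfl) measurableSet_Ioi
      (hint.mono_set Set.Ioc_subset_Ioi_self) (hint.mono_set (Set.Ioi_subset_Ioi hα.le))
  rw [hG, hsplit, add_sub_cancel_right, ← Real.norm_eq_abs]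
  have hb := norm_setIntegral_le_of_norm_le_const (μ := volume) (s := Set.Ioc 0 α)
    (f := fun t : ℝ => t ^ s * Real.exp (-t)) (C := α ^ s) (by simp) (fun t ht => by
      have ht0 : 0 ≤ t := ht.1.le
      rw [Real.norm_of_nonneg (by positivity)]
      calc t ^ s * Real.exp (-t) ≤ α ^ s * 1 := by
            gcongr
            · exact ht.2
            · exact Real.exp_le_one_iff.mpr (by linarith)
        _ = α ^ s := mul_one _)
  simpa [hα.le] using hb

/-- The limit out-degree distribution `p_{α,β}` has a power-law tail
with exponent `β`: `k^β · p_{α,β}(k) → α^{β−1}(β−1)` as `k → ∞`. -/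
theorem powerlaw_tail_of_p
    (α β : ℝ) (hα : 0 < α) (hβ : 1 < β)
    (p : ℕ → ℝ)
    (hp : ∀ k : ℕ, p k = α ^ (β - 1) * (β - 1) / (k.factorial : ℝ) *
      ∫ t in Set.Ioi α, t ^ ((k : ℝ) - β) * Real.exp (-t)) :
    Tendsto (fun k : ℕ => (k : ℝ) ^ β * p k) atTop
      (𝓝 (α ^ (β - 1) * (β - 1))) := by
  have hmain : Tendsto (fun k : ℕ => (k : ℝ) ^ β / k.factorial * Real.Gamma (k - β + 1))
      atTop (𝓝 1) := by
    refine (Real.tendsto_Gamma_add_div (-β)).congr fun k => ?_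
    rw [Real.rpow_neg k.cast_nonneg, show (k : ℝ) + 1 + -β = k - β + 1 by ring]
    simp only [div_eq_mul_inv, mul_inv, inv_inv]
    ring
  have herr : Tendsto (fun k : ℕ => (k : ℝ) ^ β / k.factorial * (Real.Gamma (k - β + 1) -
      ∫ t in Set.Ioi α, t ^ ((k : ℝ) - β) * Real.exp (-t))) atTop (𝓝 0) := by
    have hbound := (tendsto_rpow_mul_pow_div_factorial β α).mul_const (α ^ (-β) * α)
    rw [zero_mul] at hbound
    refine squeeze_zero_norm' ?_ hbound
    filter_upwards [tendsto_natCast_atTop_atTop.eventually_ge_atTop β] with k hk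
    rw [norm_mul, Real.norm_of_nonneg (by positivity), Real.norm_eq_abs]
    calc _ ≤ (k : ℝ) ^ β / k.factorial * (α ^ ((k : ℝ) - β) * α) := by
          gcongr
          exact abs_Gamma_sub_setIntegral_Ioi_le hα (by linarith)
      _ = _ := by
          rw [sub_eq_add_neg, Real.rpow_add hα, Real.rpow_natCast]
          ring
  have h := (hmain.sub herr).const_mul (α ^ (β - 1) * (β - 1))
  rw [sub_zero, mul_one] at h
  refine h.congr fun k => ?_
  rw [hp]
  ring
end

section
/- Fix α > 0, β > 1, and let g : [0,∞) → ℝ be measurable with 0 < c₁ ≤ g(t) ≤ c₂ < ∞ for all t ≥ 0. Define q_{α,β,g}(k) := (1/k!) · (∫_α^∞ t^{k−β} e^{−t} g(t) dt)/(∫_α^∞ t^{−β} g(t) dt) for integers k ≥ 0. Then (c₁/c₂) p_{α,β}(k) ≤ q_{α,β,g}(k) ≤ (c₂/c₁) p_{α,β}(k) for every k, and consequently (c₁/c₂) α^{β−1}(β−1) ≤ liminf_{k→∞} k^β q_{α,β,g}(k) ≤ limsup_{k→∞} k^β q_{α,β,g}(k) ≤ (c₂/c₁) α^{β−1}(β−1);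 in particular q_{α,β,g} has power-law tails of exponent β. -/
open MeasureTheory Filter Topology

theorem Gamma_add_natCast_add_one_eq_prod {s : ℝ} (hs : 0 < s) (n : ℕ) :
    Real.Gamma (n + 1 + s) = Real.Gamma s * ∏ j ∈ Finset.range (n + 1), (s + j) := by
  induction n with
  | zero => simp [add_comm, Real.Gamma_add_one hs.ne', mul_comm]
  | succ n ih =>
    rw [Finset.prod_range_succ, ← mul_assoc, ← ih]
    have h : ((n : ℝ) + 1 + s) ≠ 0 := by positivity
    push_cast
    rw [show (n : ℝ) + 1 + 1 + s = (n + 1 + s) + 1 by ring, Real.Gamma_add_one h]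
    ring

theorem tendsto_Gamma_add_mul_rpow_div_factorial_of_pos {s : ℝ} (hs : 0 < s) :
    Tendsto (fun n : ℕ => Real.Gamma (n + 1 + s) * (n : ℝ) ^ (-s) / n.factorial)
      atTop (𝓝 1) := by
  have hG : Real.Gamma s ≠ 0 := (Real.Gamma_pos_of_pos hs).ne'
  have h := (tendsto_const_nhds (x := Real.Gamma s)).div (Real.GammaSeq_tendsto_Gamma s) hG
  rw [div_self hG] at h
  refine h.congr fun n => ?_
  simp only [Pi.div_apply]
  rw [Gamma_add_natCast_add_one_eq_prod hs, Real.GammaSeq, Real.rpow_neg n.cast_nonneg,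
    div_div_eq_mul_div, div_mul_eq_div_div, div_eq_mul_inv _ ((n : ℝ) ^ s)]

theorem tendsto_Gamma_add_mul_rpow_div_factorial (s : ℝ) :
    Tendsto (fun n : ℕ => Real.Gamma (n + 1 + s) * (n : ℝ) ^ (-s) / n.factorial)
      atTop (𝓝 1) := by
  obtain ⟨m, hm⟩ := exists_nat_gt (-s)
  induction m generalizing s with
  | zero =>
    exact tendsto_Gamma_add_mul_rpow_div_factorial_of_pos (by push_cast at hm; linarith)
  | succ m ih =>
    have h1 := ih (s + 1) (by push_cast at hm; linarith)
    have h2 : Tendsto (fun n : ℕ => (n : ℝ) / (n + (1 + s))) atTop (𝓝 1) :=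
      tendsto_natCast_div_add_atTop (1 + s)
    have h := h1.mul h2
    rw [one_mul] at h
    refine h.congr' ?_
    filter_upwards [eventually_gt_atTop 0,
      tendsto_natCast_atTop_atTop.eventually_gt_atTop (-(1 + s))] with n hn hns
    have hn' : (0 : ℝ) < n := by exact_mod_cast hn
    have hns' : (0 : ℝ) < n + 1 + s := by linarith
    have hpow : (n : ℝ) ^ (-s) = (n : ℝ) ^ (-(s + 1)) * n := by
      rw [← Real.rpow_add_one hn'.ne']
      ring_nf
    rw [show (n : ℝ) + 1 + (s + 1) = (n + 1 + s) + 1 by ring, Real.Gamma_add_one hns'.ne', hpow,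
      ← add_assoc]
    field_simp

theorem integrableOn_rpow_mul_exp_neg_Ioi {α : ℝ} (hα : 0 < α) (s : ℝ) :
    IntegrableOn (fun t : ℝ => t ^ s * Real.exp (-t)) (Set.Ioi α) := by
  refine integrable_of_isBigO_exp_neg (b := 1 / 2) (by norm_num) ?_ ?_
  · refine ContinuousOn.mul (fun t ht => ?_) (by fun_prop)
    exact (Real.continuousAt_rpow_const _ _ (Or.inl (hα.trans_le ht).ne')).continuousWithinAt
  · simpa [mul_comm] using (Real.Gamma_integrand_isLittleO s).isBigO

theorem tendsto_rpow_div_factorial_mul_integral_Ioi {α : ℝ} (hα : 0 < α) (β : ℝ) :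
    Tendsto (fun k : ℕ => (k : ℝ) ^ β / k.factorial *
      ∫ t in Set.Ioi α, t ^ ((k : ℝ) - β) * Real.exp (-t)) atTop (𝓝 1) := by
  have hΓ := tendsto_Gamma_add_mul_rpow_div_factorial (-β)
  have hlow : Tendsto (fun k : ℕ => (k : ℝ) ^ β / k.factorial *
      ∫ t in Set.Ioc 0 α, t ^ ((k : ℝ) - β) * Real.exp (-t)) atTop (𝓝 0) := by
    have h1 := FloorSemiring.tendsto_pow_div_factorial_atTop (α * Real.exp 1)
    have h2 := (tendsto_rpow_mul_exp_neg_mul_atTop_nhds_zero β 1 one_pos).comp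
      (tendsto_natCast_atTop_atTop (R := ℝ))
    have h3 := (h1.mul h2).mul_const (α ^ (1 - β))
    rw [mul_zero, zero_mul] at h3
    refine squeeze_zero' ?_ ?_ h3
    · refine Eventually.of_forall fun k => mul_nonneg (by positivity) ?_
      exact setIntegral_nonneg measurableSet_Ioc fun t ht =>
        mul_nonneg (Real.rpow_nonneg ht.1.le _) (Real.exp_pos _).le
    · filter_upwards [tendsto_natCast_atTop_atTop.eventually_ge_atTop β] with k hk
      have hint : ∫ t in Set.Ioc 0 α, t ^ ((k : ℝ) - β) * Real.exp (-t) ≤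
          α ^ ((k : ℝ) - β) * α := by
        have := norm_setIntegral_le_of_norm_le_const (μ := volume) (s := Set.Ioc 0 α)
          (f := fun t => t ^ ((k : ℝ) - β) * Real.exp (-t)) (C := α ^ ((k : ℝ) - β))
          (by simp) (fun t ht => by
            rw [Real.norm_of_nonneg
              (mul_nonneg (Real.rpow_nonneg ht.1.le _) (Real.exp_pos _).le)]
            refine (mul_le_of_le_one_right (Real.rpow_nonneg ht.1.le _)
              (Real.exp_le_one_iff.2 (by linarith [ht.1]))).trans ?_
            exact Real.rpow_le_rpow ht.1.le ht.2 (by linarith))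
        simpa [hα.le] using (le_abs_self _).trans this
      refine (mul_le_mul_of_nonneg_left hint (by positivity)).trans_eq ?_
      have e1 : α ^ ((k : ℝ) - β) * α = α ^ k * α ^ (1 - β) := by
        rw [← Real.rpow_add_one hα.ne', ← Real.rpow_natCast α k, ← Real.rpow_add hα]
        ring_nf
      have e2 : Real.exp 1 ^ k * Real.exp (-(k : ℝ)) = 1 := by
        rw [← Real.exp_nat_mul, ← Real.exp_add]
        simp
      simp only [Function.comp_apply]
      rw [e1, mul_pow, neg_mul, one_mul]
      linear_combination (-(k : ℝ) ^ β / k.factorial * (α ^ k * α ^ (1 - β))) * e2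
  have h := hΓ.sub hlow
  rw [sub_zero] at h
  refine h.congr' ?_
  filter_upwards [tendsto_natCast_atTop_atTop.eventually_ge_atTop β] with k hk
  have hpos : 0 < (k : ℝ) + 1 + -β := by linarith
  have hI : IntegrableOn (fun t : ℝ => t ^ ((k : ℝ) - β) * Real.exp (-t)) (Set.Ioi 0) := by
    have := Real.GammaIntegral_convergent hpos
    simp only [mul_comm (Real.exp _)] at this
    convert this using 4
    ring
  have hE : Real.Gamma (k + 1 + -β) =
      (∫ t in Set.Ioc 0 α, t ^ ((k : ℝ) - β) * Real.exp (-t)) +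
        ∫ t in Set.Ioi α, t ^ ((k : ℝ) - β) * Real.exp (-t) := by
    rw [← setIntegral_union Set.Ioc_disjoint_Ioi_same measurableSet_Ioi
      (hI.mono_set Set.Ioc_subset_Ioi_self) (hI.mono_set (Set.Ioi_subset_Ioi hα.le)),
      Set.Ioc_union_Ioi_eq_Ioi hα.le, Real.Gamma_eq_integral hpos]
    refine integral_congr_ae (Eventually.of_forall fun t => ?_)
    simp only
    rw [mul_comm, show (k : ℝ) + 1 + -β - 1 = k - β by ring]
  rw [hE, neg_neg]
  ring

theorem setIntegral_mul_mem_Icc {X : Type*} [MeasurableSpace X] {μ : Measure X} {S : Set X}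
    (hS : MeasurableSet S) {f g : X → ℝ} (hf : IntegrableOn f S μ) (hf0 : ∀ t ∈ S, 0 ≤ f t)
    (hgmeas : Measurable g) {c₁ c₂ : ℝ} (hg : ∀ t ∈ S, c₁ ≤ g t ∧ g t ≤ c₂) :
    ∫ t in S, f t * g t ∂μ ∈ Set.Icc (c₁ * ∫ t in S, f t ∂μ) (c₂ * ∫ t in S, f t ∂μ) := by
  have hfg : IntegrableOn (fun t => f t * g t) S μ := by
    refine Integrable.mul_bdd (c := max |c₁| |c₂|) hf hgmeas.aestronglyMeasurable ?_
    filter_upwards [ae_restrict_mem hS] with t ht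
    exact abs_le_max_abs_abs (hg t ht).1 (hg t ht).2
  rw [← integral_const_mul, ← integral_const_mul]
  constructor
  · refine setIntegral_mono_on (hf.const_mul _) hfg hS fun t ht => ?_
    rw [mul_comm]
    exact mul_le_mul_of_nonneg_left (hg t ht).1 (hf0 t ht)
  · refine setIntegral_mono_on hfg (hf.const_mul _) hS fun t ht => ?_
    rw [mul_comm c₂]
    exact mul_le_mul_of_nonneg_left (hg t ht).2 (hf0 t ht)

/-- With a mixing density multiplied by a function `g` bounded between
`c₁` and `c₂`, the probabilities `q_{α,β,g}` are sandwiched between multiples of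
`p_{α,β}` and hence have power-law tails of exponent `β`. -/
theorem powerlaw_tail_of_q
    (α β : ℝ) (hα : 0 < α) (hβ : 1 < β)
    (g : ℝ → ℝ) (hgmeas : Measurable g)
    (c₁ c₂ : ℝ) (hc₁ : 0 < c₁)
    (hg : ∀ t : ℝ, 0 ≤ t → c₁ ≤ g t ∧ g t ≤ c₂)
    (p : ℕ → ℝ)
    (hp : ∀ k : ℕ, p k = α ^ (β - 1) * (β - 1) / (k.factorial : ℝ) *
      ∫ t in Set.Ioi α, t ^ ((k : ℝ) - β) * Real.exp (-t))
    (q : ℕ → ℝ)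
    (hq : ∀ k : ℕ, q k = (1 / (k.factorial : ℝ)) *
      ((∫ t in Set.Ioi α, t ^ ((k : ℝ) - β) * Real.exp (-t) * g t) /
        (∫ t in Set.Ioi α, t ^ (-β) * g t))) :
    (∀ k : ℕ, c₁ / c₂ * p k ≤ q k ∧ q k ≤ c₂ / c₁ * p k) ∧
    c₁ / c₂ * (α ^ (β - 1) * (β - 1)) ≤
        Filter.liminf (fun k : ℕ => (k : ℝ) ^ β * q k) atTop ∧
    Filter.liminf (fun k : ℕ => (k : ℝ) ^ β * q k) atTop ≤
        Filter.limsup (fun k : ℕ => (k : ℝ) ^ β * q k) atTop ∧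
    Filter.limsup (fun k : ℕ => (k : ℝ) ^ β * q k) atTop ≤
        c₂ / c₁ * (α ^ (β - 1) * (β - 1)) := by
  have hc₂ : 0 < c₂ := hc₁.trans_le ((hg 0 le_rfl).1.trans (hg 0 le_rfl).2)
  have hgα : ∀ t ∈ Set.Ioi α, c₁ ≤ g t ∧ g t ≤ c₂ := fun t ht => hg t (hα.trans ht).le
  have hβ' : 0 < β - 1 := by linarith
  have hA : 0 < α ^ (β - 1) * (β - 1) := mul_pos (Real.rpow_pos_of_pos hα _) hβ'
  have hD := setIntegral_mul_mem_Icc measurableSet_Ioi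
    (integrableOn_Ioi_rpow_of_lt (by linarith : -β < -1) hα)
    (fun t ht => Real.rpow_nonneg (hα.trans ht).le _) hgmeas hgα
  have hDval : ∫ t in Set.Ioi α, t ^ (-β) = (α ^ (β - 1) * (β - 1))⁻¹ := by
    rw [integral_Ioi_rpow_of_lt (by linarith) hα, mul_inv, ← Real.rpow_neg hα.le,
      show -β + 1 = -(β - 1) by ring, div_neg, neg_div, neg_neg, div_eq_mul_inv]
  rw [hDval] at hD
  have hsand : ∀ k : ℕ, c₁ / c₂ * p k ≤ q k ∧ q k ≤ c₂ / c₁ * p k := by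
    intro k
    have hf0 : ∀ t ∈ Set.Ioi α, 0 ≤ t ^ ((k : ℝ) - β) * Real.exp (-t) := fun t ht =>
      mul_nonneg (Real.rpow_nonneg (hα.trans ht).le _) (Real.exp_pos _).le
    have hN := setIntegral_mul_mem_Icc measurableSet_Ioi
      (integrableOn_rpow_mul_exp_neg_Ioi hα ((k : ℝ) - β)) hf0 hgmeas hgα
    have hF := setIntegral_nonneg (μ := volume) measurableSet_Ioi hf0
    rw [hp, hq]
    generalize ∫ t in Set.Ioi α, t ^ ((k : ℝ) - β) * Real.exp (-t) * g t = N at *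
    generalize ∫ t in Set.Ioi α, t ^ ((k : ℝ) - β) * Real.exp (-t) = F at *
    generalize ∫ t in Set.Ioi α, t ^ (-β) * g t = D at *
    generalize α ^ (β - 1) * (β - 1) = A at *
    have hD0 : 0 < D := lt_of_lt_of_le (by positivity) hD.1
    have hN0 : 0 ≤ N := le_trans (by positivity) hN.1
    constructor
    · calc c₁ / c₂ * (A / k.factorial * F)
          = 1 / k.factorial * (c₁ * F / (c₂ * A⁻¹)) := by field_simp
        _ ≤ _ := mul_le_mul_of_nonneg_left (div_le_div₀ hN0 hN.1 hD0 hD.2) (by positivity)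
    · calc 1 / (k.factorial : ℝ) * (N / D)
          ≤ 1 / k.factorial * (c₂ * F / (c₁ * A⁻¹)) :=
            mul_le_mul_of_nonneg_left
              (div_le_div₀ (by positivity) hN.2 (by positivity) hD.1) (by positivity)
        _ = _ := by field_simp
  have hlim : Tendsto (fun k : ℕ => (k : ℝ) ^ β * p k) atTop
      (𝓝 (α ^ (β - 1) * (β - 1))) := by
    have h := (tendsto_rpow_div_factorial_mul_integral_Ioi hα β).const_mul
      (α ^ (β - 1) * (β - 1))
    rw [mul_one] at h
    refine h.congr fun k => ?_
    rw [hp]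
    ring
  have hlo := hlim.const_mul (c₁ / c₂)
  have hup := hlim.const_mul (c₂ / c₁)
  have hle₁ : ∀ k : ℕ, c₁ / c₂ * ((k : ℝ) ^ β * p k) ≤ (k : ℝ) ^ β * q k := fun k => by
    rw [mul_left_comm]
    exact mul_le_mul_of_nonneg_left (hsand k).1 (by positivity)
  have hle₂ : ∀ k : ℕ, (k : ℝ) ^ β * q k ≤ c₂ / c₁ * ((k : ℝ) ^ β * p k) := fun k => by
    rw [mul_left_comm (c₂ / c₁)]
    exact mul_le_mul_of_nonneg_left (hsand k).2 (by positivity)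
  have hbelow : IsBoundedUnder (· ≥ ·) atTop (fun k : ℕ => (k : ℝ) ^ β * q k) :=
    hlo.isBoundedUnder_ge.mono_ge (Eventually.of_forall hle₁)
  have habove : IsBoundedUnder (· ≤ ·) atTop (fun k : ℕ => (k : ℝ) ^ β * q k) :=
    hup.isBoundedUnder_le.mono_le (Eventually.of_forall hle₂)
  refine ⟨hsand, ?_, liminf_le_limsup habove hbelow, ?_⟩
  · rw [← hlo.liminf_eq]
    exact liminf_le_liminf (Eventually.of_forall hle₁) hlo.isBoundedUnder_ge
      habove.isCoboundedUnder_ge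
  · rw [← hup.limsup_eq]
    exact limsup_le_limsup (Eventually.of_forall hle₂) hbelow.isCoboundedUnder_le
      hup.isBoundedUnder_le
end

section
/- Let α > 1, s > 1, let Φ(1,s,α) := Σ_{m≥0} (α+m)^{−s}, and define f_{α,s}(x) := (Γ(s) Φ(1,s,α))^{−1} ∫_0^∞ e^{−x(e^τ − 1)} τ^{s−1} e^{−τ(α−1)} dτ for x > 0. Then for every integer k ≥ 0, ∫_0^∞ (t^k/k!) e^{−t} f_{α,s}(t) dt = (Φ(1,s,α))^{−1} (α+k)^{−s}; that is, the Poisson mixture with mixing density f_{α,s} is exactly the normalized Lerch (shifted zeta) distribution k ↦ (Φ(1,s,α))^{−1}(α+k)^{−s}. -/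
open MeasureTheory Filter Topology

theorem integrableOn_rpow_mul_exp_neg_mul_Ioi {a r : ℝ} (ha : 0 < a) (hr : 0 < r) :
    IntegrableOn (fun t : ℝ ↦ t ^ (a - 1) * Real.exp (-(r * t))) (Set.Ioi 0) := by
  refine (integrableOn_rpow_mul_exp_neg_mul_rpow (s := a - 1) (p := 1) (b := r)
    (by linarith) one_pos hr).congr_fun (fun t _ ↦ ?_) measurableSet_Ioi
  simp

theorem integrableOn_pow_mul_exp_neg_mul_Ioi (k : ℕ) {r : ℝ} (hr : 0 < r) :
    IntegrableOn (fun t : ℝ ↦ t ^ k / (k.factorial : ℝ) * Real.exp (-(r * t))) (Set.Ioi 0) := by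
  refine IntegrableOn.congr_fun ((integrableOn_rpow_mul_exp_neg_mul_Ioi (a := k + 1)
    (by positivity) hr).const_mul (k.factorial : ℝ)⁻¹) (fun t _ ↦ ?_) measurableSet_Ioi
  simp only [add_sub_cancel_right, Real.rpow_natCast]
  ring

theorem integral_pow_mul_exp_neg_mul_Ioi (k : ℕ) {r : ℝ} (hr : 0 < r) :
    ∫ t in Set.Ioi (0 : ℝ), t ^ k / (k.factorial : ℝ) * Real.exp (-(r * t)) = r⁻¹ ^ (k + 1) := by
  have h := Real.integral_rpow_mul_exp_neg_mul_Ioi (a := k + 1) (by positivity) hr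
  simp only [add_sub_cancel_right, Real.rpow_natCast, Real.Gamma_nat_eq_factorial] at h
  have hk : (k.factorial : ℝ) ≠ 0 := by positivity
  simp only [div_mul_eq_mul_div, integral_div, h]
  rw [mul_div_cancel_right₀ _ hk, one_div]
  exact_mod_cast Real.rpow_natCast r⁻¹ (k + 1)

/-- The joint integrand of the Poisson mixture, in the Poisson intensity `t` and the
mixing variable `τ`. -/
noncomputable def poissonMixtureKernel (α s : ℝ) (k : ℕ) (t τ : ℝ) : ℝ :=
  t ^ k / (k.factorial : ℝ) * Real.exp (-(Real.exp τ * t)) *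
    (τ ^ (s - 1) * Real.exp (-((α - 1) * τ)))

theorem measurable_poissonMixtureKernel (α s : ℝ) (k : ℕ) :
    Measurable (Function.uncurry (poissonMixtureKernel α s k)) := by
  unfold poissonMixtureKernel Function.uncurry
  fun_prop

theorem integral_poissonMixtureKernel (α s : ℝ) (k : ℕ) (τ : ℝ) :
    ∫ t in Set.Ioi (0 : ℝ), poissonMixtureKernel α s k t τ =
      τ ^ (s - 1) * Real.exp (-((α + k) * τ)) := by
  simp only [poissonMixtureKernel, integral_mul_const,
    integral_pow_mul_exp_neg_mul_Ioi k (Real.exp_pos τ)]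
  rw [← Real.exp_neg, ← Real.exp_nat_mul, mul_left_comm, ← Real.exp_add]
  congr 2
  push_cast
  ring

theorem integrable_poissonMixtureKernel {α s : ℝ} (hα : 0 < α) (hs : 0 < s) (k : ℕ) :
    Integrable (Function.uncurry (poissonMixtureKernel α s k))
      ((volume.restrict (Set.Ioi 0)).prod (volume.restrict (Set.Ioi 0))) := by
  rw [integrable_prod_iff' (measurable_poissonMixtureKernel α s k).aestronglyMeasurable]
  refine ⟨Eventually.of_forall fun τ ↦
    (integrableOn_pow_mul_exp_neg_mul_Ioi k (Real.exp_pos τ)).mul_const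
      (τ ^ (s - 1) * Real.exp (-((α - 1) * τ))), ?_⟩
  refine IntegrableOn.congr_fun (integrableOn_rpow_mul_exp_neg_mul_Ioi (a := s) (r := α + k) hs
    (by positivity)) (fun τ hτ ↦ ?_) measurableSet_Ioi
  have hτ : 0 < τ := hτ
  rw [← integral_poissonMixtureKernel]
  refine setIntegral_congr_fun measurableSet_Ioi fun t ht ↦ ?_
  have ht : 0 < t := ht
  refine (Real.norm_of_nonneg ?_).symm
  simp only [poissonMixtureKernel]
  positivity

/-- The Poisson mixture with mixing density `f_{α,s}` is exactly the
normalized Lerch (shifted zeta) distribution `k ↦ Φ(1,s,α)⁻¹ (α+k)^{−s}`. -/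
theorem poisson_mixture_lerch
    (α s : ℝ) (hα : 1 < α) (hs : 1 < s)
    (Φ : ℝ) (hΦ : Φ = ∑' m : ℕ, (α + (m : ℝ)) ^ (-s))
    (f : ℝ → ℝ)
    (hf : ∀ x : ℝ, f x = (Real.Gamma s * Φ)⁻¹ *
      ∫ τ in Set.Ioi (0 : ℝ),
        Real.exp (-x * (Real.exp τ - 1)) * τ ^ (s - 1) * Real.exp (-τ * (α - 1)))
    (k : ℕ) :
    (∫ t in Set.Ioi (0 : ℝ), (t ^ k / (k.factorial : ℝ)) * Real.exp (-t) * f t)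
      = Φ⁻¹ * (α + (k : ℝ)) ^ (-s) := by
  have hα0 : 0 < α := by linarith
  have hs0 : 0 < s := by linarith
  have hαk : 0 < α + k := by positivity
  have key (t : ℝ) : t ^ k / (k.factorial : ℝ) * Real.exp (-t) * f t =
      (Real.Gamma s * Φ)⁻¹ * ∫ τ in Set.Ioi (0 : ℝ), poissonMixtureKernel α s k t τ := by
    rw [hf, mul_left_comm, ← integral_const_mul]
    congr 2 with τ
    have h : Real.exp (-(Real.exp τ * t)) =
        Real.exp (-t) * Real.exp (-t * (Real.exp τ - 1)) := by
      rw [← Real.exp_add]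
      ring_nf
    rw [poissonMixtureKernel, h, show -((α - 1) * τ) = -τ * (α - 1) by ring]
    ring
  simp only [key, integral_const_mul]
  rw [integral_integral_swap (integrable_poissonMixtureKernel hα0 hs0 k)]
  simp only [integral_poissonMixtureKernel]
  rw [Real.integral_rpow_mul_exp_neg_mul_Ioi hs0 hαk, one_div, Real.inv_rpow hαk.le,
    ← Real.rpow_neg hαk.le, mul_inv]
  have := (Real.Gamma_pos_of_pos hs0).ne'
  field_simp
end

section
/- Let η > 0, and let m_n → ∞ with m_n/n^η = o(1); set b_n := m_n^{1/η}. Suppose r_n : (0,1) → ℝ are measurable functions satisfying, for some constants α > 0 and C < ∞ and all t ∈ (0,1) and all n: |r_n(t)| ≤ C·( 1{nt < α}·(1 + (nt)^{−η}) + n^{−η} ). Then for every x > 0, (∫_0^1 r_n(t) t^{⌊b_n x⌋} (1−t)^{n−⌊b_n x⌋−1} dt)/B(⌊b_n x⌋+1, n−⌊b_n x⌋) = o(1/m_n) as n → ∞. -/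
open MeasureTheory Filter Topology

theorem integrableOn_pow_mul_one_sub_pow (k l : ℕ) :
    IntegrableOn (fun t : ℝ => t ^ k * (1 - t) ^ l) (Set.Ioo 0 1) :=
  ((by fun_prop : Continuous fun t : ℝ => t ^ k * (1 - t) ^ l).integrableOn_Icc).mono_set
    Set.Ioo_subset_Icc_self

theorem setIntegral_Ioo_eq_intervalIntegral (f : ℝ → ℝ) :
    ∫ t in Set.Ioo (0 : ℝ) 1, f t = ∫ t in (0 : ℝ)..1, f t := by
  rw [intervalIntegral.integral_of_le zero_le_one, integral_Ioc_eq_integral_Ioo]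

theorem integral_pow_mul_one_sub_pow_pos (k l : ℕ) :
    0 < ∫ t in Set.Ioo (0 : ℝ) 1, t ^ k * (1 - t) ^ l := by
  rw [setIntegral_Ioo_eq_intervalIntegral]
  refine intervalIntegral.intervalIntegral_pos_of_pos_on
    ((by fun_prop : Continuous fun t : ℝ => t ^ k * (1 - t) ^ l).intervalIntegrable _ _) ?_
    zero_lt_one
  intro t ht
  have := sub_pos.2 ht.2
  have := ht.1
  positivity

/-- The recurrence of the Beta function in its first argument, at natural arguments. -/
theorem succ_mul_integral_pow_mul_one_sub_pow (k l : ℕ) :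
    (k + 1 : ℝ) * ∫ t in Set.Ioo (0 : ℝ) 1, t ^ k * (1 - t) ^ l =
      (k + l + 2 : ℝ) * ∫ t in Set.Ioo (0 : ℝ) 1, t ^ (k + 1) * (1 - t) ^ l := by
  rw [setIntegral_Ioo_eq_intervalIntegral, setIntegral_Ioo_eq_intervalIntegral]
  have hderiv : ∀ t ∈ Set.uIcc (0 : ℝ) 1,
      HasDerivAt (fun t : ℝ => t ^ (k + 1) * (1 - t) ^ (l + 1))
        ((k + 1 : ℝ) * (t ^ k * (1 - t) ^ l) - (k + l + 2 : ℝ) * (t ^ (k + 1) * (1 - t) ^ l))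
        t := by
    intro t _
    have h := (hasDerivAt_pow (k + 1) t).mul (((hasDerivAt_id t).const_sub 1).pow (l + 1))
    refine h.congr_deriv ?_
    simp only [id, Pi.pow_apply, Nat.add_sub_cancel]
    push_cast
    ring
  have h := intervalIntegral.integral_eq_sub_of_hasDerivAt hderiv
    ((by fun_prop : Continuous fun t : ℝ =>
      (k + 1 : ℝ) * (t ^ k * (1 - t) ^ l) -
        (k + l + 2 : ℝ) * (t ^ (k + 1) * (1 - t) ^ l)).intervalIntegrable _ _)
  rw [intervalIntegral.integral_sub
    ((by fun_prop : Continuous fun t : ℝ =>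
      (k + 1 : ℝ) * (t ^ k * (1 - t) ^ l)).intervalIntegrable _ _)
    ((by fun_prop : Continuous fun t : ℝ =>
      (k + l + 2 : ℝ) * (t ^ (k + 1) * (1 - t) ^ l)).intervalIntegrable _ _),
    intervalIntegral.integral_const_mul, intervalIntegral.integral_const_mul] at h
  simp only [sub_self, ne_eq, Nat.add_eq_zero_iff, one_ne_zero, and_false, not_false_eq_true,
    zero_pow, mul_zero, zero_mul] at h
  linarith

theorem integral_pow_mul_one_sub_pow_le (a l q : ℕ) :
    (a + 1 : ℝ) ^ q * ∫ t in Set.Ioo (0 : ℝ) 1, t ^ a * (1 - t) ^ l ≤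
      (a + q + l + 1 : ℝ) ^ q * ∫ t in Set.Ioo (0 : ℝ) 1, t ^ (a + q) * (1 - t) ^ l := by
  induction q with
  | zero => simp
  | succ q ih =>
    have hrec := succ_mul_integral_pow_mul_one_sub_pow (a + q) l
    have hpos := integral_pow_mul_one_sub_pow_pos (a + q) l
    have hpos' := integral_pow_mul_one_sub_pow_pos (a + q + 1) l
    push_cast at hrec ⊢
    rw [← add_assoc a q 1]
    set I := ∫ t in Set.Ioo (0 : ℝ) 1, t ^ (a + q) * (1 - t) ^ l
    set J := ∫ t in Set.Ioo (0 : ℝ) 1, t ^ (a + q + 1) * (1 - t) ^ l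
    calc _ = (a + 1 : ℝ) * ((a + 1 : ℝ) ^ q * ∫ t in Set.Ioo (0 : ℝ) 1, t ^ a * (1 - t) ^ l) := by
          ring
      _ ≤ (a + q + 1 : ℝ) * ((a + q + l + 1 : ℝ) ^ q * I) := by
          have hI := (integral_pow_mul_one_sub_pow_pos a l).le
          gcongr
          exact le_add_of_nonneg_right (Nat.cast_nonneg q)
      _ = (a + q + l + 1 : ℝ) ^ q * ((a + q + l + 2) * J) := by rw [← hrec]; ring
      _ ≤ (a + q + l + 2 : ℝ) ^ q * ((a + q + l + 2) * J) := by
          gcongr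
          norm_num
      _ = _ := by ring

theorem indicator_one_add_rpow_neg_le {η α s : ℝ} (hα : 0 < α) (hs : 0 < s) {q : ℕ}
    (hq : η ≤ q) :
    (if s < α then 1 + s ^ (-η) else 0) ≤ (1 + α ^ (-η)) * (α / s) ^ q := by
  split_ifs with h
  · have h1 : 1 ≤ α / s := (one_le_div hs).2 h.le
    have h2 : s ^ (-η) = α ^ (-η) * (α / s) ^ η := by
      rw [Real.div_rpow hα.le hs.le, Real.rpow_neg hα.le, Real.rpow_neg hs.le]
      have := (Real.rpow_pos_of_pos hα η).ne'
      field_simp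
    have h3 : (α / s) ^ η ≤ (α / s) ^ q := by
      rw [← Real.rpow_natCast]
      exact Real.rpow_le_rpow_of_exponent_le h1 hq
    rw [h2, add_mul, one_mul]
    gcongr
    exact one_le_pow₀ h1
  · positivity

/-- The Beta-weighted average of a function obeying the pointwise remainder bound. -/
theorem abs_betaAverage_le {η α C : ℝ} (hα : 0 < α) {q : ℕ} (hq : η ≤ q)
    (a l : ℕ) {f : ℝ → ℝ} {N : ℝ} (hN : N = a + q + l + 1)
    (hf : ∀ t ∈ Set.Ioo (0 : ℝ) 1,
      |f t| ≤ C * ((if N * t < α then 1 + (N * t) ^ (-η) else 0) + N ^ (-η))) :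
    |(∫ t in Set.Ioo (0 : ℝ) 1, f t * t ^ (a + q) * (1 - t) ^ l) /
        ∫ t in Set.Ioo (0 : ℝ) 1, t ^ (a + q) * (1 - t) ^ l| ≤
      |C| * ((1 + α ^ (-η)) * α ^ q / (a + 1 : ℝ) ^ q + N ^ (-η)) := by
  have hNpos : 0 < N := by rw [hN]; positivity
  have hJ := integral_pow_mul_one_sub_pow_pos (a + q) l
  have hIJ := integral_pow_mul_one_sub_pow_le a l q
  rw [← hN] at hIJ
  have hnum : |∫ t in Set.Ioo (0 : ℝ) 1, f t * t ^ (a + q) * (1 - t) ^ l| ≤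
      ∫ t in Set.Ioo (0 : ℝ) 1,
        (|C| * ((1 + α ^ (-η)) * α ^ q / N ^ q) * (t ^ a * (1 - t) ^ l) +
          |C| * N ^ (-η) * (t ^ (a + q) * (1 - t) ^ l)) := by
    rw [← Real.norm_eq_abs]
    refine norm_integral_le_of_norm_le
      (((integrableOn_pow_mul_one_sub_pow a l).const_mul _).add
        ((integrableOn_pow_mul_one_sub_pow (a + q) l).const_mul _)) ?_
    refine (ae_restrict_iff' measurableSet_Ioo).2 (Eventually.of_forall fun t ht => ?_)
    have ht0 : 0 < t := ht.1
    have ht1 : 0 < 1 - t := sub_pos.2 ht.2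
    have hw : 0 < t ^ (a + q) * (1 - t) ^ l := by positivity
    have hs : 0 < N * t := by positivity
    have hind := indicator_one_add_rpow_neg_le hα hs hq
    have hnonneg : 0 ≤ (if N * t < α then 1 + (N * t) ^ (-η) else 0) + N ^ (-η) := by
      split_ifs <;> positivity
    rw [Real.norm_eq_abs, mul_assoc, abs_mul, abs_of_pos hw]
    calc |f t| * (t ^ (a + q) * (1 - t) ^ l)
        ≤ |C| * ((1 + α ^ (-η)) * (α / (N * t)) ^ q + N ^ (-η)) *
            (t ^ (a + q) * (1 - t) ^ l) := by
          gcongr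
          exact (hf t ht).trans ((mul_le_mul_of_nonneg_right (le_abs_self C) hnonneg).trans
            (by gcongr))
      _ = _ := by
          rw [div_pow, mul_pow, pow_add]
          field_simp
  rw [integral_add ((integrableOn_pow_mul_one_sub_pow a l).const_mul _)
        ((integrableOn_pow_mul_one_sub_pow (a + q) l).const_mul _),
    integral_const_mul, integral_const_mul] at hnum
  rw [abs_div, abs_of_pos hJ, div_le_iff₀ hJ]
  refine hnum.trans ?_
  set I := ∫ t in Set.Ioo (0 : ℝ) 1, t ^ a * (1 - t) ^ l
  set J := ∫ t in Set.Ioo (0 : ℝ) 1, t ^ (a + q) * (1 - t) ^ l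
  have hI : I ≤ N ^ q * J / (a + 1 : ℝ) ^ q := by
    rw [le_div_iff₀ (by positivity)]
    linarith
  calc _ ≤ |C| * ((1 + α ^ (-η)) * α ^ q / N ^ q) * (N ^ q * J / (a + 1 : ℝ) ^ q) +
        |C| * N ^ (-η) * J := by gcongr
    _ = _ := by field_simp

/-- A pointwise bound on the remainders `r_n` implies the
`o(1/m_n)` remainder condition needed in the hub-size limit theorem. -/
theorem remainder_condition_of_pointwise_bound
    (η : ℝ) (hη : 0 < η)
    (m : ℕ → ℕ) (hmtop : Tendsto m atTop atTop)
    (hmo : Tendsto (fun n : ℕ => (m n : ℝ) / (n : ℝ) ^ η) atTop (𝓝 0))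
    (b : ℕ → ℝ) (hb : ∀ n, b n = (m n : ℝ) ^ (1 / η))
    (r : ℕ → ℝ → ℝ) (hrmeas : ∀ n, Measurable (r n))
    (α C : ℝ) (hα : 0 < α)
    (hbound : ∀ n : ℕ, ∀ t ∈ Set.Ioo (0 : ℝ) 1,
      |r n t| ≤ C * ((if (n : ℝ) * t < α then 1 + ((n : ℝ) * t) ^ (-η) else 0) +
        (n : ℝ) ^ (-η)))
    (B : ℝ → ℝ → ℝ)
    (hB : ∀ u v : ℝ, B u v = ∫ w in Set.Ioo (0 : ℝ) 1, w ^ (u - 1) * (1 - w) ^ (v - 1))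
    (x : ℝ) (hx : 0 < x) :
    Tendsto (fun n : ℕ => (m n : ℝ) *
        ((∫ t in Set.Ioo (0 : ℝ) 1,
            r n t * t ^ (⌊x * b n⌋₊) * (1 - t) ^ ((n : ℝ) - (⌊x * b n⌋₊ : ℝ) - 1)) /
          B ((⌊x * b n⌋₊ : ℝ) + 1) ((n : ℝ) - (⌊x * b n⌋₊ : ℝ))))
      atTop (𝓝 0) := by
  obtain ⟨q, hq⟩ := exists_nat_gt η
  have hbtop : Tendsto b atTop atTop := by
    rw [funext hb]
    exact (tendsto_rpow_atTop (by positivity)).comp (tendsto_natCast_atTop_atTop.comp hmtop)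
  have hktop : Tendsto (fun n => ⌊x * b n⌋₊) atTop atTop :=
    tendsto_nat_floor_atTop.comp (hbtop.const_mul_atTop hx)
  have hatop : Tendsto (fun n => ((⌊x * b n⌋₊ - q : ℕ) : ℝ) + 1) atTop atTop :=
    tendsto_atTop_add_const_right _ _
      (tendsto_natCast_atTop_atTop.comp ((tendsto_sub_atTop_nat q).comp hktop))
  have hlt : ∀ᶠ n : ℕ in atTop, ⌊x * b n⌋₊ < n := by
    filter_upwards [hmo.eventually_lt_const (Real.rpow_pos_of_pos (inv_pos.2 hx) η),
      eventually_gt_atTop 0] with n hn hn0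
    have hn0' : (0 : ℝ) < n := Nat.cast_pos.2 hn0
    rw [div_lt_iff₀ (by positivity), ← Real.mul_rpow (by positivity) hn0'.le] at hn
    have hbn : b n < x⁻¹ * n := by
      rw [hb, one_div]
      exact (Real.rpow_inv_lt_iff_of_pos (by positivity) (by positivity) hη).2 hn
    have hbn0 : 0 ≤ b n := by rw [hb]; positivity
    rw [Nat.floor_lt (by positivity)]
    calc x * b n < x * (x⁻¹ * n) := by gcongr
      _ = n := by field_simp
  have hlim : Tendsto (fun n : ℕ =>
      |C| * ((1 + α ^ (-η)) * α ^ q * (((q + 1 : ℝ) / x) ^ η *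
        (((⌊x * b n⌋₊ - q : ℕ) : ℝ) + 1) ^ (-(q - η))) + (m n : ℝ) / (n : ℝ) ^ η))
      atTop (𝓝 0) := by
    have h := (tendsto_rpow_neg_atTop (sub_pos.2 hq)).comp hatop
    simpa using (((h.const_mul (((q + 1 : ℝ) / x) ^ η)).const_mul
      ((1 + α ^ (-η)) * α ^ q)).add hmo).const_mul |C|
  refine squeeze_zero_norm' ?_ hlim
  filter_upwards [hlt, hktop.eventually_ge_atTop q] with n hkn hqk
  obtain ⟨a, ha⟩ := Nat.exists_eq_add_of_le' hqk
  obtain ⟨l, hl⟩ := Nat.exists_eq_add_of_lt hkn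
  have hN : (n : ℝ) = a + q + l + 1 := by
    rw [hl, ha]
    push_cast
    ring
  have hkb := Nat.lt_floor_add_one (x * b n)
  rw [ha] at hkb ⊢
  have hv : (n : ℝ) - ((a + q : ℕ) : ℝ) - 1 = l := by
    rw [hN]
    push_cast
    ring
  have hm : (m n : ℝ) ≤ ((q + 1 : ℝ) / x) ^ η * (a + 1 : ℝ) ^ η := by
    have hmb : (m n : ℝ) = b n ^ η := by
      rw [hb, ← Real.rpow_mul (by positivity), one_div_mul_cancel hη.ne', Real.rpow_one]
    have hbn0 : 0 ≤ b n := by rw [hb]; positivity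
    rw [hmb, ← Real.mul_rpow (by positivity) (by positivity)]
    gcongr
    rw [div_mul_eq_mul_div, le_div_iff₀ hx]
    push_cast at hkb
    nlinarith [mul_nonneg (Nat.cast_nonneg (α := ℝ) q) (Nat.cast_nonneg (α := ℝ) a)]
  have hmain := abs_betaAverage_le hα hq.le a l hN (hbound n)
  rw [hB, hv]
  simp only [add_sub_cancel_right, Real.rpow_natCast]
  rw [Real.norm_eq_abs, abs_mul, Nat.abs_cast, Nat.add_sub_cancel]
  calc _ ≤ (m n : ℝ) * (|C| * ((1 + α ^ (-η)) * α ^ q / (a + 1 : ℝ) ^ q + (n : ℝ) ^ (-η))) := by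
        gcongr
    _ = |C| * ((1 + α ^ (-η)) * α ^ q * ((m n : ℝ) / (a + 1 : ℝ) ^ q) +
          (m n : ℝ) / (n : ℝ) ^ η) := by
        rw [Real.rpow_neg (Nat.cast_nonneg n)]
        ring
    _ ≤ _ := by
        gcongr
        rw [neg_sub, Real.rpow_sub (by positivity), Real.rpow_natCast, ← mul_div_assoc]
        gcongr
end

section
/- Let F be a distribution function on [0,∞) such that 1 − F(x) = (c_η/x^η)(1 + h(x)) for all x > 0, where η > 0, 0 < c_η < ∞, and |h(x)| ≤ A(x^{−δ₁} + x^{−δ₂}) for some A < ∞ and δ₁, δ₂ > 0. For each n with F(n) > 0, let π_n be the probability measure on [0,1] with distribution function F_n(x) := F(xn)/F(n), and define the remainder r_n(t) := π_n((t,1]) − (c_η/F(n))·(nt)^{−η} for t ∈ (0,1). Let m_n → ∞ with m_n/n^η = o(1) and b_n := m_n^{1/η}. Then for every x > 0, (∫_0^1 r_n(t) t^{⌊b_n x⌋} (1−t)^{n−⌊b_n x⌋−1} dt)/B(⌊b_n x⌋+1, n−⌊b_n x⌋) = o(1/m_n) as n → ∞. -/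
open MeasureTheory Filter Topology

open ProbabilityTheory in
/-- The Beta integrand is integrable on the unit interval and integrates to the Beta function. -/
theorem integrableOn_and_integral_rpow_mul_one_sub_rpow {u v : ℝ} (hu : 0 < u) (hv : 0 < v) :
    IntegrableOn (fun w : ℝ => w ^ (u - 1) * (1 - w) ^ (v - 1)) (Set.Ioo 0 1) ∧
      ∫ w in Set.Ioo (0 : ℝ) 1, w ^ (u - 1) * (1 - w) ^ (v - 1) = beta u v := by
  have hβ := beta_pos hu hv
  have hnonneg : 0 ≤ᵐ[volume.restrict (Set.Ioo (0 : ℝ) 1)]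
      fun w : ℝ => 1 / beta u v * w ^ (u - 1) * (1 - w) ^ (v - 1) := by
    filter_upwards [ae_restrict_mem measurableSet_Ioo] with w hw
    have h₁ : 0 < w := hw.1
    have h₂ : 0 < 1 - w := sub_pos.2 hw.2
    simp only [Pi.zero_apply]
    positivity
  have hmeas : Measurable fun w : ℝ => 1 / beta u v * w ^ (u - 1) * (1 - w) ^ (v - 1) := by
    fun_prop
  have hlint := lintegral_betaPDF_eq_one hu hv
  rw [lintegral_betaPDF] at hlint
  have hint := integral_eq_lintegral_of_nonneg_ae hnonneg hmeas.aestronglyMeasurable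
  rw [hlint, ENNReal.toReal_one] at hint
  have hintegrable := (lintegral_ofReal_ne_top_iff_integrable
    hmeas.aestronglyMeasurable hnonneg).1 (by rw [hlint]; exact ENNReal.one_ne_top)
  simp only [mul_assoc] at hint hintegrable
  refine ⟨?_, ?_⟩
  · refine (hintegrable.const_mul (beta u v)).congr (Eventually.of_forall fun w => ?_)
    field_simp
  · rw [integral_const_mul] at hint
    field_simp at hint
    exact hint

open ProbabilityTheory in
theorem beta_eq_mul_beta_add_one {a l : ℝ} (ha : 0 < a) (hl : 0 < l) :
    beta a l = (a + l) / a * beta (a + 1) l := by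
  have hΓ : Real.Gamma (a + l) ≠ 0 := (Real.Gamma_pos_of_pos (add_pos ha hl)).ne'
  have hal : a + l ≠ 0 := (add_pos ha hl).ne'
  unfold beta
  rw [show a + 1 + l = a + l + 1 by ring, Real.Gamma_add_one ha.ne', Real.Gamma_add_one hal]
  field_simp

open ProbabilityTheory in
theorem beta_le_pow_mul_beta_add {M l : ℝ} (hl : 0 < l) (p : ℕ) :
    ∀ {a : ℝ}, 0 < a → (a + l) / a ≤ M → beta a l ≤ M ^ p * beta (a + p) l := by
  induction p with
  | zero => intro a ha hM; simp
  | succ p ih =>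
    intro a ha hM
    have hM₀ : 0 ≤ M := le_trans (by positivity) hM
    have hstep : (a + 1 + l) / (a + 1) ≤ M := by
      refine le_trans ?_ hM
      rw [div_le_div_iff₀ (by positivity) ha]
      nlinarith
    have hrec := ih (by positivity : 0 < a + 1) hstep
    have hβ := beta_pos (by positivity : 0 < a + 1) hl
    calc beta a l = (a + l) / a * beta (a + 1) l := beta_eq_mul_beta_add_one ha hl
      _ ≤ M * beta (a + 1) l := by gcongr
      _ ≤ M * (M ^ p * beta (a + 1 + p) l) := by gcongr
      _ = M ^ (p + 1) * beta (a + (p + 1 : ℕ)) l := by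
        push_cast
        rw [show a + 1 + (p : ℝ) = a + (p + 1) by ring]
        ring

theorem rpow_neg_le_rpow_neg_mul_one_add_pow {s z q : ℝ} {p : ℕ} (hs : 0 ≤ s) (hsp : s ≤ p)
    (hz : 0 < z) (hq : 0 < q) : z ^ (-s) ≤ q ^ (-s) * (1 + (q / z) ^ p) := by
  have hqz : 0 < q / z := div_pos hq hz
  have hbound : (q / z) ^ s ≤ 1 + (q / z) ^ p := by
    rcases le_total (q / z) 1 with hle | hle
    · exact (Real.rpow_le_one hqz.le hle hs).trans (le_add_of_nonneg_right (by positivity))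
    · have := Real.rpow_le_rpow_of_exponent_le hle hsp
      rw [Real.rpow_natCast] at this
      linarith
  calc z ^ (-s) = q ^ (-s) * (q / z) ^ s := by
        rw [Real.div_rpow hq.le hz.le, Real.rpow_neg hz.le, Real.rpow_neg hq.le]
        have : q ^ s ≠ 0 := (Real.rpow_pos_of_pos hq s).ne'
        field_simp
    _ ≤ _ := by gcongr

open ProbabilityTheory in
/-- The mean of `g` under the `Beta(k + 1, n - k)` distribution is of order `ε` as soon as
`g` is dominated by `ε (1 + (k / (n t)) ^ p)`. -/
theorem abs_integral_div_beta_le {g : ℝ → ℝ} {ε : ℝ} {k n p : ℕ} (hε : 0 ≤ ε) (hp : 1 ≤ p)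
    (hpk : 2 * p ≤ k) (hkn : k < n)
    (hg : ∀ t ∈ Set.Ioo (0 : ℝ) 1, |g t| ≤ ε * (1 + ((k : ℝ) / (n * t)) ^ p)) :
    |(∫ t in Set.Ioo (0 : ℝ) 1, g t * t ^ k * (1 - t) ^ ((n : ℝ) - k - 1)) /
      beta ((k : ℝ) + 1) ((n : ℝ) - k)| ≤ ε * (1 + 2 ^ p) := by
  have hp' : (1 : ℝ) ≤ p := by exact_mod_cast hp
  have hpk' : 2 * (p : ℝ) ≤ k := by exact_mod_cast hpk
  have hkn' : (k : ℝ) < n := by exact_mod_cast hkn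
  have hk : (0 : ℝ) < k := by linarith
  have hn : (0 : ℝ) < n := by linarith
  have hl : 0 < (n : ℝ) - k := by linarith
  have ha : 0 < (k : ℝ) + 1 - p := by linarith
  obtain ⟨hI₁, hE₁⟩ := integrableOn_and_integral_rpow_mul_one_sub_rpow
    (by linarith : (0 : ℝ) < k + 1) hl
  obtain ⟨hI₂, hE₂⟩ := integrableOn_and_integral_rpow_mul_one_sub_rpow ha hl
  have hβ := beta_pos (by linarith : (0 : ℝ) < k + 1) hl
  have hβ' : beta ((k : ℝ) + 1 - p) (n - k) ≤ (2 * n / k) ^ p * beta ((k : ℝ) + 1) (n - k) := by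
    have := beta_le_pow_mul_beta_add (M := 2 * n / k) hl p ha (by
      rw [div_le_div_iff₀ ha hk]
      nlinarith)
    rwa [sub_add_cancel] at this
  have hle := norm_integral_le_of_norm_le
    (μ := volume.restrict (Set.Ioo (0 : ℝ) 1))
    (f := fun t => g t * t ^ k * (1 - t) ^ ((n : ℝ) - k - 1))
    ((hI₁.const_mul ε).add (hI₂.const_mul (ε * ((k : ℝ) / n) ^ p))) (by
      filter_upwards [ae_restrict_mem measurableSet_Ioo] with t ht
      have ht₀ : 0 < t := ht.1
      have ht₁ : 0 < 1 - t := sub_pos.2 ht.2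
      have hpow : t ^ ((k : ℝ) + 1 - p - 1) = t ^ k / t ^ p := by
        rw [show (k : ℝ) + 1 - p - 1 = (k : ℝ) - p by ring, Real.rpow_sub ht₀,
          Real.rpow_natCast, Real.rpow_natCast]
      have hw : 0 < t ^ k * (1 - t) ^ ((n : ℝ) - k - 1) := by positivity
      rw [mul_assoc, Real.norm_eq_abs, abs_mul, abs_of_pos hw]
      refine (mul_le_mul_of_nonneg_right (hg t ht) hw.le).trans_eq ?_
      simp only [Pi.add_apply]
      rw [hpow, add_sub_cancel_right, Real.rpow_natCast, div_pow, div_pow, mul_pow]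
      field_simp)
  simp only [Pi.add_apply] at hle
  rw [integral_add (hI₁.const_mul ε) (hI₂.const_mul _), integral_const_mul, integral_const_mul,
    hE₁, hE₂, Real.norm_eq_abs] at hle
  rw [abs_div, abs_of_pos hβ, div_le_iff₀ hβ]
  refine hle.trans ?_
  calc ε * beta ((k : ℝ) + 1) (n - k)
        + ε * ((k : ℝ) / n) ^ p * beta ((k : ℝ) + 1 - p) (n - k)
      ≤ ε * beta ((k : ℝ) + 1) (n - k)
        + ε * ((k : ℝ) / n) ^ p * ((2 * n / k) ^ p * beta ((k : ℝ) + 1) (n - k)) := by gcongr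
    _ = ε * (1 + ((k : ℝ) / n * (2 * n / k)) ^ p) * beta ((k : ℝ) + 1) (n - k) := by
      rw [mul_pow]; ring
    _ = ε * (1 + 2 ^ p) * beta ((k : ℝ) + 1) (n - k) := by
      congr 4
      field_simp

/-- If `m / k ^ η` stays bounded and `k → ∞`, then `m * k ^ (-(η + δ)) → 0` for `δ > 0`. -/
theorem tendsto_mul_rpow_neg_add {m k : ℕ → ℝ} {η δ C : ℝ} (hδ : 0 < δ)
    (hk : Tendsto k atTop atTop) (hm : ∀ᶠ n in atTop, 0 ≤ m n ∧ m n ≤ C * k n ^ η) :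
    Tendsto (fun n => m n * k n ^ (-(η + δ))) atTop (𝓝 0) := by
  have hlim : Tendsto (fun n => C * k n ^ (-δ)) atTop (𝓝 0) := by
    simpa using ((tendsto_rpow_neg_atTop hδ).comp hk).const_mul C
  refine squeeze_zero' ?_ ?_ hlim
  · filter_upwards [hm, hk.eventually_gt_atTop 0] with n hn hkn
    have := hn.1
    positivity
  · filter_upwards [hm, hk.eventually_gt_atTop 0] with n hn hkn
    calc m n * k n ^ (-(η + δ)) ≤ C * k n ^ η * k n ^ (-(η + δ)) := by
          gcongr; exact hn.2
      _ = C * k n ^ (-δ) := by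
          rw [mul_assoc, ← Real.rpow_add hkn]
          congr 2
          ring

/-- If the distribution function `F` satisfies
`1 − F(x) = (c_η/x^η)(1 + h(x))` with `|h(x)| ≤ A(x^{−δ₁}+x^{−δ₂})`, then the
remainders `r_n(t) = π_n((t,1]) − (c_η/F(n))(nt)^{−η}` (where
`π_n((t,1]) = 1 − F(nt)/F(n)`) satisfy the `o(1/m_n)` remainder condition needed
in the hub-size limit theorem, provided `m_n → ∞` and `m_n/n^η = o(1)`. -/
theorem remainder_condition_of_frechet_tail
    (η cη : ℝ) (hη : 0 < η) (hcη : 0 < cη)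
    (F h : ℝ → ℝ) (hFmono : Monotone F) (hF0 : ∀ x ≤ (0 : ℝ), F x = 0)
    (hF : ∀ x : ℝ, 0 < x → 1 - F x = (cη / x ^ η) * (1 + h x))
    (A δ₁ δ₂ : ℝ) (hδ₁ : 0 < δ₁) (hδ₂ : 0 < δ₂)
    (hh : ∀ x : ℝ, 0 < x → |h x| ≤ A * (x ^ (-δ₁) + x ^ (-δ₂)))
    (r : ℕ → ℝ → ℝ)
    (hr : ∀ n : ℕ, ∀ t : ℝ,
      r n t = (F n - F ((n : ℝ) * t)) / F n - (cη / F n) * ((n : ℝ) * t) ^ (-η))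
    (m : ℕ → ℕ) (hmtop : Tendsto m atTop atTop)
    (hmo : Tendsto (fun n : ℕ => (m n : ℝ) / (n : ℝ) ^ η) atTop (𝓝 0))
    (b : ℕ → ℝ) (hb : ∀ n, b n = (m n : ℝ) ^ (1 / η))
    (B : ℝ → ℝ → ℝ)
    (hB : ∀ u v : ℝ, B u v = ∫ w in Set.Ioo (0 : ℝ) 1, w ^ (u - 1) * (1 - w) ^ (v - 1))
    (x : ℝ) (hx : 0 < x) :
    Tendsto (fun n : ℕ => (m n : ℝ) *
        ((∫ t in Set.Ioo (0 : ℝ) 1,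
            r n t * t ^ (⌊x * b n⌋₊) * (1 - t) ^ ((n : ℝ) - (⌊x * b n⌋₊ : ℝ) - 1)) /
          B ((⌊x * b n⌋₊ : ℝ) + 1) ((n : ℝ) - (⌊x * b n⌋₊ : ℝ))))
      atTop (𝓝 0) := by
  have hA : 0 ≤ A := by
    have := (abs_nonneg _).trans (hh 1 one_pos)
    simp only [Real.one_rpow] at this
    linarith
  set k : ℕ → ℕ := fun n => ⌊x * b n⌋₊
  have hncast : Tendsto (fun n : ℕ => (n : ℝ)) atTop atTop := tendsto_natCast_atTop_atTop
  have hmcast : Tendsto (fun n : ℕ => (m n : ℝ)) atTop atTop :=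
    tendsto_natCast_atTop_atTop.comp hmtop
  have hbtop : Tendsto b atTop atTop := by
    rw [show b = fun n => (m n : ℝ) ^ (1 / η) from funext hb]
    exact (tendsto_rpow_atTop (by positivity)).comp hmcast
  have hb₀ : ∀ n, 0 ≤ b n := fun n => by rw [hb]; positivity
  have hktop : Tendsto k atTop atTop := tendsto_nat_floor_atTop.comp (hbtop.const_mul_atTop hx)
  have hkcast : Tendsto (fun n => (k n : ℝ)) atTop atTop :=
    tendsto_natCast_atTop_atTop.comp hktop
  have hbpow : ∀ n, b n ^ η = m n := fun n => by
    rw [hb, ← Real.rpow_mul (by positivity), one_div_mul_cancel hη.ne', Real.rpow_one]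
  have hmk : ∀ᶠ n in atTop, (0 : ℝ) ≤ m n ∧ (m n : ℝ) ≤ (2 / x) ^ η * (k n : ℝ) ^ η := by
    filter_upwards [hktop.eventually_ge_atTop 1] with n hn
    refine ⟨by positivity, ?_⟩
    have hn' : (1 : ℝ) ≤ k n := by exact_mod_cast hn
    have hlt : x * b n < k n + 1 := Nat.lt_floor_add_one _
    rw [← Real.mul_rpow (by positivity) (by positivity), ← hbpow]
    refine Real.rpow_le_rpow (hb₀ n) ?_ hη.le
    rw [div_mul_eq_mul_div, le_div_iff₀ hx]
    linarith
  have hkn : ∀ᶠ n in atTop, k n < n := by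
    have hlim : Tendsto (fun n : ℕ => ((m n : ℝ) / (n : ℝ) ^ η) * x ^ η) atTop (𝓝 0) := by
      simpa using hmo.mul_const (x ^ η)
    filter_upwards [hlim.eventually_lt_const one_pos, eventually_gt_atTop 0] with n hn hn₀
    have hn₀' : (0 : ℝ) < n := by exact_mod_cast hn₀
    have hpos : 0 < (n : ℝ) ^ η := by positivity
    rw [div_mul_eq_mul_div, div_lt_one hpos, ← hbpow,
      ← Real.mul_rpow (hb₀ n) hx.le, mul_comm (b n)] at hn
    have := (Real.rpow_lt_rpow_iff (mul_nonneg hx.le (hb₀ n)) hn₀'.le hη).1 hn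
    exact (Nat.floor_lt (mul_nonneg hx.le (hb₀ n))).2 this
  have hh₀ : Tendsto (fun n : ℕ => |h n|) atTop (𝓝 0) := by
    have hlim : Tendsto (fun n : ℕ => A * ((n : ℝ) ^ (-δ₁) + (n : ℝ) ^ (-δ₂))) atTop (𝓝 0) := by
      simpa using ((((tendsto_rpow_neg_atTop hδ₁).comp hncast).add
        ((tendsto_rpow_neg_atTop hδ₂).comp hncast)).const_mul A)
    refine squeeze_zero' (Eventually.of_forall fun n => abs_nonneg _) ?_ hlim
    filter_upwards [eventually_gt_atTop 0] with n hn
    exact hh n (by exact_mod_cast hn)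
  have hFn : ∀ᶠ n : ℕ in atTop, (1 / 2 : ℝ) ≤ F n := by
    have hlim : Tendsto (fun n : ℕ => cη * (n : ℝ) ^ (-η) * (1 + |h n|)) atTop (𝓝 0) := by
      simpa using (((tendsto_rpow_neg_atTop hη).comp hncast).const_mul cη).mul
        (hh₀.const_add 1)
    filter_upwards [hlim.eventually_lt_const (by norm_num : (0 : ℝ) < 1 / 2),
      eventually_gt_atTop 0] with n hn hn₀
    have hn₀' : (0 : ℝ) < n := by exact_mod_cast hn₀
    have h₁ := hF n hn₀'
    have h₂ : (cη / (n : ℝ) ^ η) * (1 + h n) ≤ cη * (n : ℝ) ^ (-η) * (1 + |h n|) := by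
      rw [Real.rpow_neg hn₀'.le, ← div_eq_mul_inv]
      gcongr
      exact le_abs_self _
    linarith
  set ε : ℕ → ℝ := fun n => 2 * (cη * A * (k n : ℝ) ^ (-(η + δ₁))
    + cη * A * (k n : ℝ) ^ (-(η + δ₂)) + cη * (n : ℝ) ^ (-η) * (1 + |h n|)) with hεdef
  have hεlim : Tendsto (fun n => (m n : ℝ) * ε n) atTop (𝓝 0) := by
    have h₁ := (tendsto_mul_rpow_neg_add hδ₁ hkcast hmk).const_mul (cη * A)
    have h₂ := (tendsto_mul_rpow_neg_add hδ₂ hkcast hmk).const_mul (cη * A)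
    have h₃ := (hmo.const_mul cη).mul (hh₀.const_add 1)
    have h₄ := ((h₁.add h₂).add h₃).const_mul 2
    simp only [mul_zero, zero_mul, add_zero] at h₄
    refine h₄.congr fun n => ?_
    simp only [hεdef]
    rw [Real.rpow_neg (Nat.cast_nonneg n)]
    ring
  obtain ⟨p, hp⟩ := exists_nat_ge (1 + η + δ₁ + δ₂)
  have hp₁ : 1 ≤ p := by
    have : (1 : ℝ) ≤ p := by linarith
    exact_mod_cast this
  have hlim : Tendsto (fun n => (m n : ℝ) * ε n * (1 + 2 ^ p)) atTop (𝓝 0) := by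
    simpa using hεlim.mul_const (1 + 2 ^ p : ℝ)
  refine squeeze_zero_norm' ?_ hlim
  filter_upwards [hkn, hFn, hktop.eventually_ge_atTop (2 * p)] with n hkn hFn hpk
  have hkn' : (k n : ℝ) < n := by exact_mod_cast hkn
  have hk₀ : (0 : ℝ) < k n := by
    have : 0 < k n := by omega
    exact_mod_cast this
  have hn₀ : (0 : ℝ) < n := hk₀.trans hkn'
  have hε₀ : 0 ≤ ε n := by
    simp only [hεdef]
    positivity
  have hr_le : ∀ t ∈ Set.Ioo (0 : ℝ) 1, |r n t| ≤ ε n * (1 + ((k n : ℝ) / (n * t)) ^ p) := by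
    intro t ht
    have ht₀ : 0 < t := ht.1
    have hz : 0 < (n : ℝ) * t := by positivity
    have hrw : r n t = (cη * ((n : ℝ) * t) ^ (-η) * h (n * t)
        - cη * (n : ℝ) ^ (-η) * (1 + h n)) / F n := by
      have h₁ := hF n hn₀
      have h₂ := hF (n * t) hz
      rw [div_eq_mul_inv, ← Real.rpow_neg hn₀.le] at h₁
      rw [div_eq_mul_inv, ← Real.rpow_neg hz.le] at h₂
      rw [hr, div_mul_eq_mul_div, ← sub_div]
      congr 1
      linear_combination h₂ - h₁
    have hfirst : |cη * ((n : ℝ) * t) ^ (-η) * h (n * t)| ≤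
        (cη * A * (k n : ℝ) ^ (-(η + δ₁)) + cη * A * (k n : ℝ) ^ (-(η + δ₂)))
          * (1 + ((k n : ℝ) / (n * t)) ^ p) := by
      have hpos : 0 < cη * ((n : ℝ) * t) ^ (-η) := by positivity
      have hb₁ := rpow_neg_le_rpow_neg_mul_one_add_pow (p := p)
        (by linarith : 0 ≤ η + δ₁) (by linarith) hz hk₀
      have hb₂ := rpow_neg_le_rpow_neg_mul_one_add_pow (p := p)
        (by linarith : 0 ≤ η + δ₂) (by linarith) hz hk₀
      rw [abs_mul, abs_of_pos hpos]
      calc cη * ((n : ℝ) * t) ^ (-η) * |h (n * t)|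
          ≤ cη * ((n : ℝ) * t) ^ (-η)
            * (A * (((n : ℝ) * t) ^ (-δ₁) + ((n : ℝ) * t) ^ (-δ₂))) := by
            gcongr
            exact hh _ hz
        _ = cη * A * (((n : ℝ) * t) ^ (-(η + δ₁)) + ((n : ℝ) * t) ^ (-(η + δ₂))) := by
            rw [neg_add, neg_add, Real.rpow_add hz, Real.rpow_add hz]
            ring
        _ ≤ cη * A * ((k n : ℝ) ^ (-(η + δ₁)) * (1 + ((k n : ℝ) / (n * t)) ^ p)
            + (k n : ℝ) ^ (-(η + δ₂)) * (1 + ((k n : ℝ) / (n * t)) ^ p)) := by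
            gcongr
        _ = _ := by ring
    have hsecond : |cη * (n : ℝ) ^ (-η) * (1 + h n)| ≤
        cη * (n : ℝ) ^ (-η) * (1 + |h n|) * (1 + ((k n : ℝ) / (n * t)) ^ p) := by
      have hpos : 0 < cη * (n : ℝ) ^ (-η) := by positivity
      rw [abs_mul, abs_of_pos hpos]
      refine le_trans ?_ (le_mul_of_one_le_right (by positivity)
        (le_add_of_nonneg_right (by positivity)))
      gcongr
      exact (abs_add_le _ _).trans_eq (by rw [abs_one])
    rw [hrw, abs_div, abs_of_pos (by linarith : 0 < F n), div_le_iff₀ (by linarith)]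
    have hsum := (abs_sub _ _).trans (add_le_add hfirst hsecond)
    refine hsum.trans ?_
    have hεQ : 0 ≤ ε n * (1 + ((k n : ℝ) / (n * t)) ^ p) := by positivity
    refine le_trans (le_of_eq ?_) (mul_le_mul_of_nonneg_left hFn hεQ)
    simp only [hεdef]
    ring
  have hmean := abs_integral_div_beta_le hε₀ hp₁ hpk hkn hr_le
  have hB' : B ((k n : ℝ) + 1) ((n : ℝ) - k n) =
      ProbabilityTheory.beta ((k n : ℝ) + 1) ((n : ℝ) - k n) := by
    rw [hB]
    exact (integrableOn_and_integral_rpow_mul_one_sub_rpow (by linarith) (by linarith)).2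
  change ‖(m n : ℝ) * ((∫ t in Set.Ioo (0 : ℝ) 1,
    r n t * t ^ k n * (1 - t) ^ ((n : ℝ) - (k n : ℝ) - 1)) /
      B ((k n : ℝ) + 1) ((n : ℝ) - k n))‖ ≤ _
  rw [hB', Real.norm_eq_abs, abs_mul, Nat.abs_cast, mul_assoc]
  gcongr
end

section
/- Let 0 < γ ≤ 1 and m_n := ⌊n/γ⌋, and let X_n be the m_n × n exchangeable random {0,1}-matrix directed by π_n, with N(X_n) the number of GF(2)-solutions of X_n^T x = 0. Let θ̃_n have law π_n and suppose T_n := n·θ̃_n converges in distribution to a random variable T with distribution function F, and that ξ_n(j) := ∫_{[0,1]}(1−2θ)^j π_n(dθ) is nonzero for all j ∈ {0,…,n} for all sufficiently large n. Then lim_{n→∞} (1/n) log E[N(X_n)] = sup_{x∈[0,1]} Θ_γ(x), where Θ_γ(x) := (1/γ)[ log(1 + ∫_{[0,∞)} e^{−2xt} dF(t)) − γ( x log x + (1−x) log(1−x) + log 2 ) ] (with the convention 0·log 0 = 0). -/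
open MeasureTheory Filter Topology
open scoped Classical

lemma pow_eq_exp_mul_log {x : ℝ} (hx : 0 ≤ x) {k : ℕ} (h : x = 0 → k = 0) :
    x ^ k = Real.exp (k * Real.log x) := by
  rcases hx.eq_or_lt with h0 | h0
  · simp [h h0.symm]
  · rw [← Real.rpow_natCast, Real.rpow_def_of_pos h0, mul_comm]

lemma frequency_pow_mul_pow_eq_exp {n j : ℕ} (hn : 0 < n) (hj : j ≤ n) :
    ((j : ℝ) / n) ^ j * (1 - (j : ℝ) / n) ^ (n - j) =
      Real.exp (-(n * Real.binEntropy ((j : ℝ) / n))) := by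
  have hn' : (0 : ℝ) < n := by exact_mod_cast hn
  have hjn : (j : ℝ) ≤ n := by exact_mod_cast hj
  have hp : (j : ℝ) / n ≤ 1 := (div_le_one hn').2 hjn
  rw [pow_eq_exp_mul_log (by positivity), pow_eq_exp_mul_log (by linarith), ← Real.exp_add]
  · congr 1
    rw [Real.binEntropy, Real.log_inv, Real.log_inv, Nat.cast_sub hj]
    field_simp
    ring
  · intro h
    have : (j : ℝ) = n := by field_simp at h; linarith
    have : j = n := by exact_mod_cast this
    omega
  · intro h
    have : (j : ℝ) = 0 := by field_simp at h; linarith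
    exact_mod_cast this

lemma choose_le_exp_binEntropy {n j : ℕ} (hn : 0 < n) (hj : j ≤ n) :
    (n.choose j : ℝ) ≤ Real.exp (n * Real.binEntropy ((j : ℝ) / n)) := by
  have hn' : (0 : ℝ) < n := by exact_mod_cast hn
  have hjn : (j : ℝ) ≤ n := by exact_mod_cast hj
  have hp : (j : ℝ) / n ≤ 1 := (div_le_one hn').2 hjn
  have hsum := add_pow ((j : ℝ) / n) (1 - (j : ℝ) / n) n
  rw [add_sub_cancel, one_pow] at hsum
  have hle : ((j : ℝ) / n) ^ j * (1 - (j : ℝ) / n) ^ (n - j) * (n.choose j) ≤ 1 := by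
    refine le_of_le_of_eq ?_ hsum.symm
    refine Finset.single_le_sum (f := fun i => ((j : ℝ) / n) ^ i * (1 - (j : ℝ) / n) ^ (n - i) *
      (n.choose i)) (fun i _ => ?_) (Finset.mem_range.2 (by omega))
    have : (0 : ℝ) ≤ 1 - (j : ℝ) / n := by linarith
    positivity
  rw [frequency_pow_mul_pow_eq_exp hn hj, Real.exp_neg, inv_mul_le_iff₀ (Real.exp_pos _)] at hle
  simpa using hle

/-- The mode of a binomial distribution with parameters `n` and `j / n` is `j`. -/
lemma binomial_weight_le_mode {n j : ℕ} (hj : j ≤ n) {i : ℕ} (hi : i ≤ n) :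
    j ^ i * (n - j) ^ (n - i) * n.choose i ≤ j ^ j * (n - j) ^ (n - j) * n.choose j := by
  have hstep : ∀ i < n, (i + 1) * ((n - j) * (j ^ (i + 1) * (n - j) ^ (n - (i + 1)) *
      n.choose (i + 1))) = (n - i) * j * (j ^ i * (n - j) ^ (n - i) * n.choose i) := by
    intro i hi
    have h := Nat.choose_succ_right_eq n i
    have h2 : n - i = n - (i + 1) + 1 := by omega
    calc _ = j * j ^ i * ((n - j) ^ (n - (i + 1)) * (n - j)) *
          (n.choose (i + 1) * (i + 1)) := by ring
      _ = j * j ^ i * (n - j) ^ (n - i) * (n.choose i * (n - i)) := by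
          rw [h, ← pow_succ, ← h2]
      _ = _ := by ring
  rcases le_total i j with hij | hij
  · induction hk : j - i generalizing i with
    | zero => obtain rfl : i = j := by omega
              rfl
    | succ k ih =>
      refine le_trans ?_ (ih (i := i + 1) (by omega) (by omega) (by omega))
      have h := hstep i (by omega)
      have hc : (i + 1) * (n - j) ≤ (n - i) * j := by
        rw [mul_comm]; exact Nat.mul_le_mul (by omega) (by omega)
      have hpos : 0 < (n - i) * j := Nat.mul_pos (by omega) (by omega)
      refine Nat.le_of_mul_le_mul_left ?_ hpos
      rw [← h, ← mul_assoc]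
      exact Nat.mul_le_mul_right _ hc
  · induction i, hij using Nat.le_induction with
    | base => rfl
    | succ i hij ih =>
      refine le_trans ?_ (ih (by omega))
      have h := hstep i (by omega)
      have hc : (n - i) * j ≤ (i + 1) * (n - j) := by
        rw [mul_comm]; exact Nat.mul_le_mul (by omega) (by omega)
      have hpos : 0 < (i + 1) * (n - j) := Nat.mul_pos (by omega) (by omega)
      refine Nat.le_of_mul_le_mul_left ?_ hpos
      rw [mul_assoc, h]
      exact Nat.mul_le_mul_right _ hc

lemma exp_binEntropy_le_mul_choose {n j : ℕ} (hn : 0 < n) (hj : j ≤ n) :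
    Real.exp (n * Real.binEntropy ((j : ℝ) / n)) ≤ (n + 1) * n.choose j := by
  have hn' : (0 : ℝ) < n := by exact_mod_cast hn
  have hscale : ∀ i ≤ n, ((j : ℝ) / n) ^ i * (1 - (j : ℝ) / n) ^ (n - i) * (n.choose i) =
      ((j ^ i * (n - j) ^ (n - i) * n.choose i : ℕ) : ℝ) / n ^ n := by
    intro i hi
    have h1 : 1 - (j : ℝ) / n = ((n - j : ℕ) : ℝ) / n := by
      rw [Nat.cast_sub hj]; field_simp
    rw [h1, div_pow, div_pow, div_mul_div_comm, ← pow_add, Nat.add_sub_cancel' hi]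
    push_cast
    ring
  have hsum := add_pow ((j : ℝ) / n) (1 - (j : ℝ) / n) n
  rw [add_sub_cancel, one_pow] at hsum
  have hle : 1 ≤ (n + 1) *
      (((j : ℝ) / n) ^ j * (1 - (j : ℝ) / n) ^ (n - j) * (n.choose j)) := by
    refine hsum.trans_le ?_
    refine (Finset.sum_le_card_nsmul _ _ (((j : ℝ) / n) ^ j *
      (1 - (j : ℝ) / n) ^ (n - j) * (n.choose j)) fun i hi => ?_).trans (by simp)
    have hi' : i ≤ n := by have := Finset.mem_range.1 hi; omega
    rw [hscale i hi', hscale j hj]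
    refine div_le_div_of_nonneg_right ?_ (by positivity)
    exact_mod_cast binomial_weight_le_mode hj hi'
  rw [frequency_pow_mul_pow_eq_exp hn hj, Real.exp_neg] at hle
  have := mul_le_mul_of_nonneg_left hle (Real.exp_pos (n * Real.binEntropy ((j : ℝ) / n))).le
  have h0 := (Real.exp_pos (n * Real.binEntropy ((j : ℝ) / n))).ne'
  field_simp at this
  linarith

/-- The nontrivial additive character of `ZMod 2`, as a monoid homomorphism to `ℝ`. -/
noncomputable def signChar : Multiplicative (ZMod 2) →* ℝ where
  toFun a := if a.toAdd = 0 then 1 else -1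
  map_one' := by simp
  map_mul' a b := by
    rw [toAdd_mul]
    generalize a.toAdd = a
    generalize b.toAdd = b
    have h : ∀ c : ZMod 2, c = 0 ∨ c = 1 := by decide
    rcases h a with rfl | rfl <;> rcases h b with rfl | rfl <;> simp [CharTwo.add_self_eq_zero]

lemma signChar_ofAdd_sum {ι : Type*} (s : Finset ι) (f : ι → ZMod 2) :
    signChar (.ofAdd (∑ i ∈ s, f i)) = ∏ i ∈ s, signChar (.ofAdd (f i)) := by
  rw [ofAdd_sum, map_prod]

lemma ite_eq_zero_eq_signChar (a : ZMod 2) :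
    (if a = 0 then (1 : ℝ) else 0) = 2⁻¹ * (1 + signChar (.ofAdd a)) := by
  by_cases h : a = 0
  · norm_num [signChar, h]
  · simp [signChar, h]

/-- Number of solutions of a linear system over `ZMod 2` through characters. -/
lemma card_solutions_eq {m n : ℕ} (e : Fin m → Fin n → ZMod 2) :
    (Fintype.card {x : Fin m → ZMod 2 // ∀ j : Fin n, (∑ i : Fin m, e i j * x i) = 0} : ℝ) =
      2⁻¹ ^ n * ∑ s : Finset (Fin n), ∑ x : Fin m → ZMod 2,
        ∏ i, ∏ j ∈ s, signChar (.ofAdd (e i j * x i)) := by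
  rw [Fintype.card_subtype, Finset.card_filter, Nat.cast_sum, Finset.sum_comm, Finset.mul_sum]
  refine Finset.sum_congr rfl fun x _ => ?_
  have h : ((if ∀ j : Fin n, (∑ i : Fin m, e i j * x i) = 0 then 1 else 0 : ℕ) : ℝ) =
      ∏ j : Fin n, if (∑ i : Fin m, e i j * x i) = 0 then (1 : ℝ) else 0 := by
    rw [Finset.prod_ite_zero]
    simp
  rw [h]
  simp_rw [ite_eq_zero_eq_signChar]
  rw [Finset.prod_mul_distrib, Finset.prod_const, Finset.card_univ, Fintype.card_fin,
    Finset.prod_one_add, Finset.powerset_univ]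
  congr 1
  refine Finset.sum_congr rfl fun s _ => ?_
  rw [Finset.prod_comm]
  exact Finset.prod_congr rfl fun j _ => signChar_ofAdd_sum _ _

/-- Mean number of solutions for a matrix with i.i.d. rows of law `p`. -/
lemma sum_prod_mul_card_solutions {m n : ℕ} (p : (Fin n → ZMod 2) → ℝ) :
    (∑ e : Fin m → Fin n → ZMod 2, (∏ i, p (e i)) *
      (Fintype.card {x : Fin m → ZMod 2 // ∀ j : Fin n, (∑ i : Fin m, e i j * x i) = 0} : ℝ)) =
      2⁻¹ ^ n * ∑ s : Finset (Fin n),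
        (∑ a : ZMod 2, ∑ r : Fin n → ZMod 2, p r * ∏ j ∈ s, signChar (.ofAdd (r j * a))) ^ m := by
  simp_rw [card_solutions_eq, mul_left_comm _ ((2 : ℝ)⁻¹ ^ n), ← Finset.mul_sum]
  congr 1
  simp_rw [Finset.mul_sum]
  rw [Finset.sum_comm]
  refine Finset.sum_congr rfl fun s _ => ?_
  rw [Finset.sum_comm]
  simp_rw [← Finset.prod_mul_distrib]
  have hp : ∀ x : Fin m → ZMod 2,
      (∑ e : Fin m → Fin n → ZMod 2, ∏ i, (p (e i) * ∏ j ∈ s, signChar (.ofAdd (e i j * x i)))) =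
      ∏ i, ∑ r : Fin n → ZMod 2, p r * ∏ j ∈ s, signChar (.ofAdd (r j * x i)) := fun x =>
    (Fintype.prod_sum fun i (r : Fin n → ZMod 2) =>
      p r * ∏ j ∈ s, signChar (.ofAdd (r j * x i))).symm
  simp_rw [hp]
  rw [← Fintype.prod_sum (fun (_ : Fin m) (a : ZMod 2) =>
    ∑ r : Fin n → ZMod 2, p r * ∏ j ∈ s, signChar (.ofAdd (r j * a)))]
  simp

lemma sum_bernoulli_mul_signChar {n : ℕ} (s : Finset (Fin n)) (a : ZMod 2) (θ : ℝ) :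
    ∑ r : Fin n → ZMod 2, (θ ^ (Finset.univ.filter (fun j => r j = 1)).card *
      (1 - θ) ^ (n - (Finset.univ.filter (fun j => r j = 1)).card)) *
        ∏ j ∈ s, signChar (.ofAdd (r j * a)) = (if a = 0 then 1 else 1 - 2 * θ) ^ s.card := by
  have h : ∀ r : Fin n → ZMod 2, (θ ^ (Finset.univ.filter (fun j => r j = 1)).card *
      (1 - θ) ^ (n - (Finset.univ.filter (fun j => r j = 1)).card)) *
        ∏ j ∈ s, signChar (.ofAdd (r j * a)) =
      ∏ j, ((if r j = 1 then θ else 1 - θ) *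
        if j ∈ s then signChar (.ofAdd (r j * a)) else 1) := by
    intro r
    rw [Finset.prod_mul_distrib, Finset.prod_ite_mem, Finset.univ_inter, Finset.prod_ite,
      Finset.prod_const, Finset.prod_const, Finset.filter_not, Finset.card_sdiff_of_subset
        (Finset.filter_subset _ _), Finset.card_univ, Fintype.card_fin]
  simp_rw [h]
  rw [← Fintype.prod_sum (fun (j : Fin n) (b : ZMod 2) => (if b = 1 then θ else 1 - θ) *
        if j ∈ s then signChar (.ofAdd (b * a)) else 1)]
  have hf : ∀ j, (∑ b : ZMod 2, (if b = 1 then θ else 1 - θ) *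
        if j ∈ s then signChar (.ofAdd (b * a)) else 1) =
        if j ∈ s then (if a = 0 then 1 else 1 - 2 * θ) else 1 := by
    intro j
    rw [show (Finset.univ : Finset (ZMod 2)) = {0, 1} from rfl,
      Finset.sum_pair (by decide)]
    by_cases hj : j ∈ s <;> by_cases ha : a = 0 <;> simp [hj, ha, signChar] <;> ring
  simp_rw [hf]
  rw [Finset.prod_ite_mem, Finset.univ_inter, Finset.prod_const]

lemma integrable_of_continuous_of_mem_Icc {ν : Measure ℝ} [IsProbabilityMeasure ν]
    (hν : ν (Set.Icc (0 : ℝ) 1) = 1) {f : ℝ → ℝ} (hf : Continuous f) : Integrable f ν := by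
  have h : ν.restrict (Set.Icc (0 : ℝ) 1) = ν :=
    Measure.restrict_eq_self_of_ae_mem ((mem_ae_iff_prob_eq_one measurableSet_Icc).2 hν)
  rw [← h]
  exact hf.continuousOn.integrableOn_compact isCompact_Icc

/-- First moment formula for exchangeable rows directed by `ν`. -/
lemma mean_solutions_eq {m n : ℕ} {ν : Measure ℝ} [IsProbabilityMeasure ν]
    (hν : ν (Set.Icc (0 : ℝ) 1) = 1) :
    (∑ e : Fin m → Fin n → ZMod 2,
      (∏ i : Fin m, ∫ θ, θ ^ ((Finset.univ.filter (fun j => e i j = 1)).card) *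
        (1 - θ) ^ (n - (Finset.univ.filter (fun j => e i j = 1)).card) ∂ν) *
      (Fintype.card
        {x : Fin m → ZMod 2 // ∀ j : Fin n, (∑ i : Fin m, e i j * x i) = 0} : ℝ)) =
      2⁻¹ ^ n * ∑ j ∈ Finset.range (n + 1), n.choose j *
        (1 + ∫ θ, (1 - 2 * θ) ^ j ∂ν) ^ m := by
  rw [sum_prod_mul_card_solutions (fun r : Fin n → ZMod 2 =>
    ∫ θ, θ ^ ((Finset.univ.filter (fun j => r j = 1)).card) *
        (1 - θ) ^ (n - (Finset.univ.filter (fun j => r j = 1)).card) ∂ν)]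
  congr 1
  have h : ∀ (s : Finset (Fin n)) (a : ZMod 2), (∑ r : Fin n → ZMod 2,
      (∫ θ, θ ^ ((Finset.univ.filter (fun j => r j = 1)).card) *
        (1 - θ) ^ (n - (Finset.univ.filter (fun j => r j = 1)).card) ∂ν) *
        ∏ j ∈ s, signChar (.ofAdd (r j * a))) =
      ∫ θ, (if a = 0 then 1 else 1 - 2 * θ) ^ s.card ∂ν := by
    intro s a
    simp_rw [← sum_bernoulli_mul_signChar s a]
    rw [integral_finsetSum _ fun r _ => integrable_of_continuous_of_mem_Icc hν (by fun_prop)]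
    exact Finset.sum_congr rfl fun r _ => (integral_mul_const _ _).symm
  simp_rw [h]
  rw [← Finset.powerset_univ, Finset.sum_powerset_apply_card
    (fun k => (∑ a : ZMod 2, ∫ θ, (if a = 0 then 1 else 1 - 2 * θ) ^ k ∂ν) ^ m)]
  simp only [Finset.card_univ, Fintype.card_fin, nsmul_eq_mul]
  refine Finset.sum_congr rfl fun k _ => ?_
  rw [show (Finset.univ : Finset (ZMod 2)) = {0, 1} from rfl, Finset.sum_pair (by decide)]
  simp

lemma abs_one_sub_sub_exp_neg_le {u : ℝ} (hu : 0 ≤ u) : |1 - u - Real.exp (-u)| ≤ u ^ 2 := by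
  rcases le_total u 1 with h | h
  · have := Real.abs_exp_sub_one_sub_id_le (x := -u) (by rwa [abs_neg, abs_of_nonneg hu])
    rw [abs_sub_comm]
    rwa [sub_neg_eq_add, neg_sq, sub_add] at this
  · have h1 := Real.add_one_le_exp (-u)
    have h2 : Real.exp (-u) ≤ 1 := Real.exp_le_one_iff.2 (by linarith)
    rw [abs_le]
    constructor <;> nlinarith

lemma abs_pow_sub_exp_le {n j : ℕ} (hn : 0 < n) (hj : j ≤ n) {θ : ℝ}
    (hθ : θ ∈ Set.Icc (0 : ℝ) 1) :
    |(1 - 2 * θ) ^ j - Real.exp (-2 * ((j : ℝ) / n) * (n * θ))| ≤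
      min 2 (4 * (n * θ) ^ 2 / n) := by
  obtain ⟨h0, h1⟩ := hθ
  have hn' : (0 : ℝ) < n := by exact_mod_cast hn
  have hjn : (j : ℝ) ≤ n := by exact_mod_cast hj
  have he : Real.exp (-2 * ((j : ℝ) / n) * (n * θ)) = Real.exp (-(2 * θ)) ^ j := by
    rw [← Real.exp_nat_mul]
    congr 1
    field_simp
  have ha : |1 - 2 * θ| ≤ 1 := abs_le.2 ⟨by linarith, by linarith⟩
  have hb : |Real.exp (-(2 * θ))| ≤ 1 := by
    rw [abs_of_pos (Real.exp_pos _)]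
    exact Real.exp_le_one_iff.2 (by linarith)
  rw [he]
  refine le_min ?_ ?_
  · refine (abs_sub _ _).trans ?_
    rw [abs_pow, abs_pow]
    linarith [pow_le_one₀ (n := j) (abs_nonneg _) ha, pow_le_one₀ (n := j) (abs_nonneg _) hb]
  · refine (abs_pow_sub_pow_le _ _ _).trans ?_
    have h2 := abs_one_sub_sub_exp_neg_le (u := 2 * θ) (by linarith)
    calc |1 - 2 * θ - Real.exp (-(2 * θ))| * j *
          max |1 - 2 * θ| |Real.exp (-(2 * θ))| ^ (j - 1)
        ≤ |1 - 2 * θ - Real.exp (-(2 * θ))| * j * 1 := by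
          gcongr
          exact pow_le_one₀ (le_max_of_le_left (abs_nonneg _)) (max_le ha hb)
      _ ≤ (2 * θ) ^ 2 * n * 1 := by gcongr
      _ = 4 * (n * θ) ^ 2 / n := by field_simp; ring

lemma exp_neg_mul_max_le_one {x : ℝ} (hx : 0 ≤ x) (t : ℝ) :
    Real.exp (-2 * x * max t 0) ≤ 1 :=
  Real.exp_le_one_iff.2 (by nlinarith [mul_nonneg hx (le_max_right t 0)])

/-- Antitone functions converging pointwise to a continuous function on `[0, 1]` converge
uniformly. -/
lemma eventually_forall_abs_sub_le_of_antitoneOn {g : ℝ → ℝ} {G : ℕ → ℝ → ℝ}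
    (hg : ContinuousOn g (Set.Icc 0 1)) (hG : ∀ n, AntitoneOn (G n) (Set.Icc 0 1))
    (hlim : ∀ x ∈ Set.Icc (0 : ℝ) 1, Tendsto (fun n => G n x) atTop (𝓝 (g x)))
    {ε : ℝ} (hε : 0 < ε) :
    ∀ᶠ n in atTop, ∀ x ∈ Set.Icc (0 : ℝ) 1, |G n x - g x| ≤ ε := by
  have huc := isCompact_Icc.uniformContinuousOn_of_continuous hg
  obtain ⟨δ, hδ, hd⟩ := Metric.uniformContinuousOn_iff.1 huc (ε / 2) (by positivity)
  obtain ⟨N, hN⟩ := exists_nat_one_div_lt hδ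
  have hN0 : (0 : ℝ) < N + 1 := by positivity
  have hgrid : ∀ i ≤ N + 1, (i : ℝ) / (N + 1) ∈ Set.Icc (0 : ℝ) 1 := fun i hi =>
    ⟨by positivity, (div_le_one hN0).2 (by exact_mod_cast hi)⟩
  have hev : ∀ᶠ n in atTop, ∀ i ∈ Finset.range (N + 2),
      |G n ((i : ℝ) / (N + 1)) - g ((i : ℝ) / (N + 1))| < ε / 2 := by
    refine (Finset.eventually_all _).2 fun i hi => ?_
    have := Metric.tendsto_nhds.1
      (hlim _ (hgrid i (by have := Finset.mem_range.1 hi; omega))) (ε / 2) (by positivity)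
    simpa [Real.dist_eq] using this
  filter_upwards [hev] with n hn x hx
  obtain ⟨i, hi, hl, hr⟩ : ∃ i ≤ N, (i : ℝ) / (N + 1) ≤ x ∧ x ≤ ((i + 1 : ℕ) : ℝ) / (N + 1) := by
    rcases hx.2.eq_or_lt with rfl | h1
    · exact ⟨N, le_rfl, (div_le_one hN0).2 (by linarith),
        (one_le_div hN0).2 (by push_cast; linarith)⟩
    · have h0 : 0 ≤ x * (N + 1) := mul_nonneg hx.1 hN0.le
      refine ⟨⌊x * (N + 1)⌋₊, ?_, ?_, ?_⟩
      · have : ⌊x * (N + 1)⌋₊ < N + 1 := (Nat.floor_lt h0).2 (by push_cast; nlinarith)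
        omega
      · exact (div_le_iff₀ hN0).2 (Nat.floor_le h0)
      · refine (le_div_iff₀ hN0).2 ?_
        push_cast
        exact (Nat.lt_floor_add_one _).le
  have hmi := hgrid i (by omega)
  have hmi' := hgrid (i + 1) (by omega)
  have hgap : ((i + 1 : ℕ) : ℝ) / (N + 1) = (i : ℝ) / (N + 1) + 1 / (N + 1) := by
    push_cast; ring
  have h1 := hd _ hmi x hx (by rw [Real.dist_eq, abs_lt]; constructor <;> linarith)
  have h2 := hd _ hmi' x hx (by rw [Real.dist_eq, abs_lt]; constructor <;> linarith)
  rw [Real.dist_eq, abs_lt] at h1 h2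
  have h3 := abs_lt.1 (hn i (Finset.mem_range.2 (by omega)))
  have h4 := abs_lt.1 (hn (i + 1) (Finset.mem_range.2 (by omega)))
  have h5 := hG n hmi hx hl
  have h6 := hG n hx hmi' hr
  rw [abs_le]
  constructor <;> linarith

section Convergence

variable {π : ℕ → Measure ℝ} {μ : Measure ℝ}

lemma integral_exp_max_eq {ν : Measure ℝ} (h : ∀ᵐ t ∂ν, 0 ≤ t) (c x : ℝ) (hc : 0 ≤ c) :
    ∫ t, Real.exp (-2 * x * max (c * t) 0) ∂ν = ∫ t, Real.exp (-2 * x * (c * t)) ∂ν :=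
  integral_congr_ae (h.mono fun t ht => by
    simp only [max_eq_left (mul_nonneg hc ht)])

lemma tendsto_laplace (hπ : ∀ n, ∀ᵐ t ∂(π n), 0 ≤ t) (hμ : ∀ᵐ t ∂μ, 0 ≤ t)
    (hconv : ∀ f : BoundedContinuousFunction ℝ ℝ,
      Tendsto (fun n : ℕ => ∫ θ, f ((n : ℝ) * θ) ∂(π n)) atTop (𝓝 (∫ t, f t ∂μ)))
    {x : ℝ} (hx : 0 ≤ x) :
    Tendsto (fun n : ℕ => ∫ θ, Real.exp (-2 * x * (n * θ)) ∂(π n)) atTop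
      (𝓝 (∫ t, Real.exp (-2 * x * t) ∂μ)) := by
  have h := hconv (BoundedContinuousFunction.ofNormedAddCommGroup
    (fun t => Real.exp (-2 * x * max t 0)) (by fun_prop) 1 fun t => by
      rw [Real.norm_of_nonneg (Real.exp_pos _).le]
      exact exp_neg_mul_max_le_one hx t)
  simp only [BoundedContinuousFunction.coe_ofNormedAddCommGroup] at h
  have h2 := integral_exp_max_eq hμ 1 x zero_le_one
  simp only [one_mul] at h2
  rw [h2] at h
  exact h.congr fun n => integral_exp_max_eq (hπ n) n x n.cast_nonneg

lemma integrable_exp_neg {ν : Measure ℝ} [IsFiniteMeasure ν] (h : ∀ᵐ t ∂ν, 0 ≤ t) {c x : ℝ}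
    (hc : 0 ≤ c) (hx : 0 ≤ x) : Integrable (fun t => Real.exp (-2 * x * (c * t))) ν := by
  refine Integrable.of_bound (by fun_prop) 1 (h.mono fun t ht => ?_)
  rw [Real.norm_of_nonneg (Real.exp_pos _).le]
  exact Real.exp_le_one_iff.2 (by have := mul_nonneg hx (mul_nonneg hc ht); linarith)

lemma antitoneOn_laplace {ν : Measure ℝ} [IsFiniteMeasure ν] (h : ∀ᵐ t ∂ν, 0 ≤ t) {c : ℝ}
    (hc : 0 ≤ c) : AntitoneOn (fun x => ∫ t, Real.exp (-2 * x * (c * t)) ∂ν) (Set.Icc 0 1) := by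
  intro x hx y hy hxy
  refine integral_mono_ae (integrable_exp_neg h hc hy.1) (integrable_exp_neg h hc hx.1)
    (h.mono fun t ht => ?_)
  have := mul_nonneg hc ht
  exact Real.exp_le_exp.2 (by nlinarith)

lemma continuousOn_laplace {ν : Measure ℝ} [IsFiniteMeasure ν] (h : ∀ᵐ t ∂ν, 0 ≤ t) :
    ContinuousOn (fun x => ∫ t, Real.exp (-2 * x * t) ∂ν) (Set.Icc 0 1) := by
  refine continuousOn_of_dominated (bound := fun _ => 1) (fun x _ => by fun_prop)
    (fun x hx => h.mono fun t ht => ?_) (integrable_const _)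
    (ae_of_all _ fun t => by fun_prop)
  rw [Real.norm_of_nonneg (Real.exp_pos _).le]
  exact Real.exp_le_one_iff.2 (by have := mul_nonneg hx.1 ht; linarith)

lemma eventually_integral_min_sq_le [IsProbabilityMeasure μ] [∀ n, IsProbabilityMeasure (π n)]
    (hconv : ∀ f : BoundedContinuousFunction ℝ ℝ,
      Tendsto (fun n : ℕ => ∫ θ, f ((n : ℝ) * θ) ∂(π n)) atTop (𝓝 (∫ t, f t ∂μ)))
    {ε : ℝ} (hε : 0 < ε) :
    ∀ᶠ n : ℕ in atTop, ∫ θ, min 2 (4 * (n * θ) ^ 2 / n) ∂(π n) < ε := by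
  have hbd : ∀ (K : ℕ) (t : ℝ), ‖min 2 (4 * t ^ 2 / K)‖ ≤ (2 : ℝ) := fun K t => by
    rw [Real.norm_of_nonneg (by positivity)]
    exact min_le_left _ _
  have hK : Tendsto (fun K : ℕ => ∫ t, min 2 (4 * t ^ 2 / (K : ℝ)) ∂μ) atTop (𝓝 0) := by
    have := tendsto_integral_of_dominated_convergence (μ := μ)
      (F := fun (K : ℕ) t => min 2 (4 * t ^ 2 / (K : ℝ))) (f := fun _ => (0 : ℝ)) (fun _ => 2)
      (fun K => by fun_prop) (integrable_const _) (fun K => ae_of_all _ (hbd K))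
      (ae_of_all _ fun t => by
        have h := (tendsto_const_nhds (x := (2 : ℝ))).min
          (tendsto_const_div_atTop_nhds_zero_nat (4 * t ^ 2))
        simpa using h)
    simpa using this
  obtain ⟨K, hKε, hK0⟩ := ((hK.eventually (gt_mem_nhds hε)).and (eventually_gt_atTop 0)).exists
  have h := hconv (BoundedContinuousFunction.ofNormedAddCommGroup
    (fun t => min 2 (4 * t ^ 2 / (K : ℝ))) (by fun_prop) 2 (hbd K))
  simp only [BoundedContinuousFunction.coe_ofNormedAddCommGroup] at h
  filter_upwards [h.eventually (gt_mem_nhds hKε), eventually_ge_atTop K] with n hn hnK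
  have hK0' : (0 : ℝ) < K := by exact_mod_cast hK0
  refine lt_of_le_of_lt (integral_mono_ae ?_ ?_ (ae_of_all _ fun θ => ?_)) hn
  · exact Integrable.of_bound (by fun_prop) 2 (ae_of_all _ fun θ => hbd n _)
  · exact Integrable.of_bound (by fun_prop) 2 (ae_of_all _ fun θ => hbd K _)
  · dsimp only
    gcongr

/-- `ξ_n(j)` is uniformly close to the Laplace transform of the limit at `2j/n`. -/
lemma eventually_abs_moment_sub_laplace_le
    [IsProbabilityMeasure μ] [∀ n, IsProbabilityMeasure (π n)]
    (hπ : ∀ n, π n (Set.Icc (0 : ℝ) 1) = 1) (hμ : ∀ᵐ t ∂μ, 0 ≤ t)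
    (hconv : ∀ f : BoundedContinuousFunction ℝ ℝ,
      Tendsto (fun n : ℕ => ∫ θ, f ((n : ℝ) * θ) ∂(π n)) atTop (𝓝 (∫ t, f t ∂μ)))
    {ε : ℝ} (hε : 0 < ε) :
    ∀ᶠ n : ℕ in atTop, ∀ j ≤ n,
      |(∫ θ, (1 - 2 * θ) ^ j ∂(π n)) - ∫ t, Real.exp (-2 * ((j : ℝ) / n) * t) ∂μ| ≤ ε := by
  have hmem : ∀ n, ∀ᵐ θ ∂(π n), θ ∈ Set.Icc (0 : ℝ) 1 := fun n =>
    (mem_ae_iff_prob_eq_one measurableSet_Icc).2 (hπ n)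
  have hpos : ∀ n, ∀ᵐ θ ∂(π n), 0 ≤ θ := fun n => (hmem n).mono fun θ h => h.1
  have hunif := eventually_forall_abs_sub_le_of_antitoneOn (continuousOn_laplace hμ)
    (fun n : ℕ => antitoneOn_laplace (hpos n) n.cast_nonneg)
    (fun x hx => tendsto_laplace hpos hμ hconv hx.1) (half_pos hε)
  filter_upwards [hunif, eventually_integral_min_sq_le hconv (half_pos hε),
    eventually_gt_atTop 0] with n h1 h2 hn j hj
  have hn' : (0 : ℝ) < n := by exact_mod_cast hn
  have hx : (j : ℝ) / n ∈ Set.Icc (0 : ℝ) 1 :=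
    ⟨by positivity, (div_le_one hn').2 (by exact_mod_cast hj)⟩
  have h3 : |(∫ θ, (1 - 2 * θ) ^ j ∂(π n)) -
      ∫ θ, Real.exp (-2 * ((j : ℝ) / n) * (n * θ)) ∂(π n)| ≤ ε / 2 := by
    rw [← integral_sub (integrable_of_continuous_of_mem_Icc (hπ n) (by fun_prop))
      (integrable_exp_neg (hpos n) hn'.le hx.1)]
    refine (norm_integral_le_of_norm_le (f := fun θ => (1 - 2 * θ) ^ j -
      Real.exp (-2 * ((j : ℝ) / n) * (n * θ)))
      (integrable_of_continuous_of_mem_Icc (hπ n) (by fun_prop))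
      ((hmem n).mono fun θ hθ => abs_pow_sub_exp_le hn hj hθ)).trans h2.le
  have h4 := h1 _ hx
  rw [abs_le] at *
  constructor <;> linarith [h3.1, h3.2, h4.1, h4.2]

end Convergence

lemma tendsto_log_add_one_div_nat :
    Tendsto (fun n : ℕ => Real.log (n + 1) / n) atTop (𝓝 0) := by
  have h := (Real.tendsto_pow_log_div_mul_add_atTop 1 (-1) 1 one_ne_zero).comp
    (tendsto_atTop_add_const_right atTop (1 : ℝ) tendsto_natCast_atTop_atTop)
  refine h.congr fun n => ?_
  simp

/-- Laplace principle for binomial sums. -/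
lemma tendsto_log_binomial_sum {γ : ℝ} (hγ : 0 < γ) {m : ℕ → ℕ}
    (hm : ∀ n, m n = ⌊(n : ℝ) / γ⌋₊) {g : ℝ → ℝ} (hg : ContinuousOn g (Set.Icc 0 1))
    (hg0 : ∀ x, 0 ≤ g x) {a : ℕ → ℕ → ℝ}
    (ha : ∀ ε > 0, ∀ᶠ n : ℕ in atTop, ∀ j ≤ n, |a n j - g ((j : ℝ) / n)| ≤ ε)
    {Θ : ℝ → ℝ}
    (hΘ : ∀ x, Θ x = Real.log (1 + g x) / γ + Real.binEntropy x - Real.log 2) :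
    Tendsto (fun n : ℕ => (1 / (n : ℝ)) * Real.log
      (2⁻¹ ^ n * ∑ j ∈ Finset.range (n + 1), n.choose j * (1 + a n j) ^ m n)) atTop
      (𝓝 (sSup (Θ '' Set.Icc (0 : ℝ) 1))) := by
  have hΘc : ContinuousOn Θ (Set.Icc 0 1) := by
    refine ContinuousOn.congr ?_ fun x _ => hΘ x
    refine (((ContinuousOn.log (by fun_prop) fun x _ => ?_).div_const γ).add
      Real.binEntropy_continuous.continuousOn).sub continuousOn_const
    linarith [hg0 x]
  obtain ⟨z, hz, hzmax⟩ := isCompact_Icc.exists_isMaxOn (Set.nonempty_Icc.2 zero_le_one) hΘc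
  have hL : sSup (Θ '' Set.Icc (0 : ℝ) 1) = Θ z :=
    IsGreatest.csSup_eq ⟨Set.mem_image_of_mem _ hz, by rintro _ ⟨y, hy, rfl⟩; exact hzmax hy⟩
  rw [hL]
  have hmle : ∀ n, (m n : ℝ) ≤ n / γ := fun n => by
    rw [hm]; exact Nat.floor_le (by positivity)
  have hmlim : Tendsto (fun n : ℕ => (m n : ℝ) / n) atTop (𝓝 (1 / γ)) := by
    refine ((tendsto_nat_floor_mul_div_atTop (a := 1 / γ) (by positivity)).comp
      tendsto_natCast_atTop_atTop).congr fun n => ?_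
    simp only [Function.comp, hm]
    congr 3
    ring
  have hmem : ∀ {n j : ℕ}, 0 < n → j ≤ n → (j : ℝ) / n ∈ Set.Icc (0 : ℝ) 1 := fun hn hj =>
    ⟨by positivity, (div_le_one (by exact_mod_cast hn)).2 (by exact_mod_cast hj)⟩
  refine tendsto_order.2 ⟨fun b hb => ?_, fun b hb => ?_⟩
  · obtain ⟨ε, hεb, hε0, hε1⟩ : ∃ ε, b < Θ z + Real.log (1 - ε) / γ ∧ 0 < ε ∧ ε < 1 := by
      have hc : ContinuousAt (fun ε : ℝ => Θ z + Real.log (1 - ε) / γ) 0 := by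
        refine continuousAt_const.add (ContinuousAt.div_const (ContinuousAt.log ?_ (by simp)) _)
        fun_prop
      have h1 := (tendsto_order.1 hc.tendsto).1 b (by simpa using hb)
      have h2 : ∀ᶠ ε : ℝ in 𝓝[>] 0, b < Θ z + Real.log (1 - ε) / γ := h1.filter_mono inf_le_left
      obtain ⟨ε, h, h'⟩ := (h2.and (Ioo_mem_nhdsGT (zero_lt_one' ℝ))).exists
      exact ⟨ε, h, h'⟩
    have hfr : Tendsto (fun n : ℕ => (⌊z * n⌋₊ : ℝ) / n) atTop (𝓝 z) :=
      (tendsto_nat_floor_mul_div_atTop hz.1).comp tendsto_natCast_atTop_atTop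
    have hjle : ∀ n : ℕ, ⌊z * n⌋₊ ≤ n := fun n => by
      refine Nat.floor_le_of_le ?_
      nlinarith [hz.2, (n.cast_nonneg : (0 : ℝ) ≤ n)]
    have hgz : Tendsto (fun n : ℕ => g ((⌊z * n⌋₊ : ℝ) / n)) atTop (𝓝 (g z)) := by
      refine (hg z hz).tendsto.comp (tendsto_nhdsWithin_iff.2 ⟨hfr, ?_⟩)
      filter_upwards [eventually_gt_atTop 0] with n hn using hmem hn (hjle n)
    have hpos : 0 < (1 - ε) * (1 + g z) := mul_pos (by linarith) (by linarith [hg0 z])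
    have hlow : Tendsto (fun n : ℕ => -Real.log 2 + Real.binEntropy ((⌊z * n⌋₊ : ℝ) / n) -
        Real.log (n + 1) / n + (m n : ℝ) / n *
          Real.log ((1 - ε) * (1 + g ((⌊z * n⌋₊ : ℝ) / n)))) atTop
        (𝓝 (Θ z + Real.log (1 - ε) / γ)) := by
      have h := (((tendsto_const_nhds (x := -Real.log 2)).add
        ((Real.binEntropy_continuous.tendsto z).comp hfr)).sub tendsto_log_add_one_div_nat).add
        (hmlim.mul ((Real.continuousAt_log hpos.ne').tendsto.comp
          ((hgz.const_add 1).const_mul (1 - ε))))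
      have hval : Θ z + Real.log (1 - ε) / γ = -Real.log 2 + Real.binEntropy z - 0 +
          1 / γ * Real.log ((1 - ε) * (1 + g z)) := by
        rw [hΘ, Real.log_mul (by linarith) (by linarith [hg0 z])]
        ring
      rw [hval]
      exact h
    filter_upwards [hlow.eventually (lt_mem_nhds hεb), ha ε hε0, ha 1 one_pos,
      eventually_gt_atTop 0] with n hb' hε ha1 hn
    refine hb'.trans_le ?_
    have hn' : (0 : ℝ) < n := by exact_mod_cast hn
    set j := ⌊z * n⌋₊ with hj
    have hjn : j ≤ n := hjle n
    have hgj := hg0 ((j : ℝ) / n)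
    have hpj : 0 < (1 - ε) * (1 + g ((j : ℝ) / n)) := mul_pos (by linarith) (by linarith)
    have hnn : ∀ i ∈ Finset.range (n + 1), 0 ≤ (n.choose i : ℝ) * (1 + a n i) ^ m n := by
      intro i hi
      have h1 := (abs_le.1 (ha1 i (by have := Finset.mem_range.1 hi; omega))).1
      have h2 := hg0 ((i : ℝ) / n)
      have : 0 ≤ 1 + a n i := by linarith
      positivity
    have hterm : Real.exp (n * Real.binEntropy ((j : ℝ) / n)) / (n + 1) *
        ((1 - ε) * (1 + g ((j : ℝ) / n))) ^ m n ≤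
        ∑ j ∈ Finset.range (n + 1), n.choose j * (1 + a n j) ^ m n := by
      refine le_trans ?_ (Finset.single_le_sum hnn (Finset.mem_range.2 (by omega : j < n + 1)))
      have h1 := (abs_le.1 (hε j hjn)).1
      refine mul_le_mul ?_ (pow_le_pow_left₀ hpj.le (by nlinarith) _) (by positivity)
        (by positivity)
      rw [div_le_iff₀ (by positivity), mul_comm (n.choose j : ℝ)]
      exact exp_binEntropy_le_mul_choose hn hjn
    have hlog := Real.log_le_log (by positivity)
      (mul_le_mul_of_nonneg_left hterm (by positivity : (0 : ℝ) ≤ 2⁻¹ ^ n))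
    rw [Real.log_mul (by positivity) (by positivity), Real.log_mul (by positivity) (by positivity),
      Real.log_div (by positivity) (by positivity), Real.log_exp, Real.log_pow, Real.log_pow,
      Real.log_inv] at hlog
    refine le_trans (le_of_eq ?_) (mul_le_mul_of_nonneg_left hlog (by positivity : 0 ≤ 1 / (n : ℝ)))
    field_simp
    ring
  · obtain ⟨ε, hεb, hε0, hε1⟩ : ∃ ε, Θ z + Real.log (1 + ε) / γ < b ∧ 0 < ε ∧ ε < 1 := by
      have hc : ContinuousAt (fun ε : ℝ => Θ z + Real.log (1 + ε) / γ) 0 := by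
        refine continuousAt_const.add (ContinuousAt.div_const (ContinuousAt.log ?_ (by simp)) _)
        fun_prop
      have h1 := (tendsto_order.1 hc.tendsto).2 b (by simpa using hb)
      have h2 : ∀ᶠ ε : ℝ in 𝓝[>] 0, Θ z + Real.log (1 + ε) / γ < b := h1.filter_mono inf_le_left
      obtain ⟨ε, h, h'⟩ := (h2.and (Ioo_mem_nhdsGT (zero_lt_one' ℝ))).exists
      exact ⟨ε, h, h'⟩
    have hup : Tendsto (fun n : ℕ => Θ z + Real.log (1 + ε) / γ + Real.log (n + 1) / n) atTop
        (𝓝 (Θ z + Real.log (1 + ε) / γ)) := by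
      simpa using tendsto_log_add_one_div_nat.const_add (Θ z + Real.log (1 + ε) / γ)
    filter_upwards [hup.eventually (gt_mem_nhds hεb), ha ε hε0, eventually_gt_atTop 0]
      with n hb' hε hn
    refine lt_of_le_of_lt ?_ hb'
    have hn' : (0 : ℝ) < n := by exact_mod_cast hn
    have hapos : ∀ j ≤ n, 0 < 1 + a n j := fun j hj => by
      linarith [(abs_le.1 (hε j hj)).1, hg0 ((j : ℝ) / n)]
    have hterm : ∀ j ∈ Finset.range (n + 1), (n.choose j : ℝ) * (1 + a n j) ^ m n ≤
        Real.exp (n * (Θ z + Real.log (1 + ε) / γ + Real.log 2)) := by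
      intro j hj
      have hjn : j ≤ n := by have := Finset.mem_range.1 hj; omega
      have hgj := hg0 ((j : ℝ) / n)
      have h1 := (abs_le.1 (hε j hjn)).2
      have hB : 1 ≤ (1 + ε) * (1 + g ((j : ℝ) / n)) := by nlinarith
      calc (n.choose j : ℝ) * (1 + a n j) ^ m n
          ≤ Real.exp (n * Real.binEntropy ((j : ℝ) / n)) *
              ((1 + ε) * (1 + g ((j : ℝ) / n))) ^ m n := by
            refine mul_le_mul (choose_le_exp_binEntropy hn hjn)
              (pow_le_pow_left₀ (hapos j hjn).le (by nlinarith) _)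
              (pow_nonneg (hapos j hjn).le _) (by positivity)
        _ = Real.exp (n * Real.binEntropy ((j : ℝ) / n) +
              m n * Real.log ((1 + ε) * (1 + g ((j : ℝ) / n)))) := by
            rw [Real.exp_add, ← Real.log_pow, Real.exp_log (by positivity)]
        _ ≤ Real.exp (n * Real.binEntropy ((j : ℝ) / n) +
              n / γ * Real.log ((1 + ε) * (1 + g ((j : ℝ) / n)))) := by
            have := Real.log_nonneg hB
            have := hmle n
            gcongr
        _ = Real.exp (n * (Θ ((j : ℝ) / n) + Real.log (1 + ε) / γ + Real.log 2)) := by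
            rw [hΘ, Real.log_mul (by linarith) (by linarith)]
            congr 1
            ring
        _ ≤ _ := by
            have : Θ ((j : ℝ) / n) ≤ Θ z := hzmax (hmem hn hjn)
            gcongr
    have hsum := Finset.sum_le_card_nsmul _ _ _ hterm
    rw [Finset.card_range, nsmul_eq_mul] at hsum
    have hspos : 0 < ∑ j ∈ Finset.range (n + 1), (n.choose j : ℝ) * (1 + a n j) ^ m n :=
      Finset.sum_pos (fun j hj => by
        have hjn : j ≤ n := by have := Finset.mem_range.1 hj; omega
        exact mul_pos (by exact_mod_cast Nat.choose_pos hjn) (pow_pos (hapos j hjn) _)) (by simp)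
    have hlog := Real.log_le_log (by positivity)
      (mul_le_mul_of_nonneg_left hsum (by positivity : (0 : ℝ) ≤ 2⁻¹ ^ n))
    rw [Real.log_mul (x := 2⁻¹ ^ n) (y := _ * _) (by positivity) (by positivity),
      Real.log_mul (x := ((n + 1 : ℕ) : ℝ)) (by positivity) (by positivity), Real.log_exp,
      Real.log_pow, Real.log_inv] at hlog
    refine (mul_le_mul_of_nonneg_left hlog (by positivity : 0 ≤ 1 / (n : ℝ))).trans (le_of_eq ?_)
    push_cast
    field_simp
    ring

/-- Large deviation rate for the mean number of GF(2)-solutions of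
`X_nᵀ x = 0`, where `X_n` is the `m_n × n` (with `m_n = ⌊n/γ⌋`) exchangeable random
`{0,1}`-matrix directed by `π_n`.  The expectation `E[N(X_n)]` is expressed as the
weighted sum, over all matrices `e`, of the number of GF(2)-solutions, each matrix
having probability `∏_i ∫ θ^{s_i}(1−θ)^{n−s_i} dπ_n` (with `s_i` the number of ones
in row `i`). -/
theorem large_deviation_mean_solutions
    (γ : ℝ) (hγ0 : 0 < γ) (hγ1 : γ ≤ 1)
    (m : ℕ → ℕ) (hm : ∀ n, m n = ⌊(n : ℝ) / γ⌋₊)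
    (π : ℕ → Measure ℝ) (hprob : ∀ n, IsProbabilityMeasure (π n))
    (hsupp : ∀ n, π n (Set.Icc (0 : ℝ) 1) = 1)
    (μ : Measure ℝ) (hμprob : IsProbabilityMeasure μ)
    (hμsupp : μ (Set.Iio (0 : ℝ)) = 0)
    (hconv : ∀ f : BoundedContinuousFunction ℝ ℝ,
      Tendsto (fun n : ℕ => ∫ θ, f ((n : ℝ) * θ) ∂(π n)) atTop (𝓝 (∫ t, f t ∂μ)))
    (hξ : ∀ᶠ n : ℕ in atTop, ∀ j ≤ n, (∫ θ, (1 - 2 * θ) ^ j ∂(π n)) ≠ 0)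
    (Θ : ℝ → ℝ)
    (hΘ : ∀ x : ℝ, Θ x = (1 / γ) *
      (Real.log (1 + ∫ t, Real.exp (-2 * x * t) ∂μ) -
        γ * (x * Real.log x + (1 - x) * Real.log (1 - x) + Real.log 2))) :
    Tendsto (fun n : ℕ => (1 / (n : ℝ)) * Real.log
        (∑ e : Fin (m n) → Fin n → ZMod 2,
          (∏ i : Fin (m n),
            ∫ θ, θ ^ ((Finset.univ.filter (fun j => e i j = 1)).card) *
              (1 - θ) ^ (n - (Finset.univ.filter (fun j => e i j = 1)).card) ∂(π n)) *
          (Fintype.card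
            {x : Fin (m n) → ZMod 2 // ∀ j : Fin n, (∑ i : Fin (m n), e i j * x i) = 0} : ℝ)))
      atTop (𝓝 (sSup (Θ '' Set.Icc (0 : ℝ) 1))) := by
  have hμ : ∀ᵐ t ∂μ, 0 ≤ t := by
    refine measure_mono_null (fun t ht => ?_) hμsupp
    simpa using ht
  have hΘ' : ∀ x, Θ x = Real.log (1 + ∫ t, Real.exp (-2 * x * t) ∂μ) / γ +
      Real.binEntropy x - Real.log 2 := by
    intro x
    rw [hΘ, Real.binEntropy, Real.log_inv, Real.log_inv]
    field_simp
    ring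
  refine (tendsto_log_binomial_sum hγ0 hm (continuousOn_laplace hμ)
    (fun x => integral_nonneg fun t => (Real.exp_pos _).le)
    (fun ε hε => eventually_abs_moment_sub_laplace_le hsupp hμ hconv hε) hΘ').congr fun n => ?_
  rw [mean_solutions_eq (hsupp n)]
end

section
/- Let F be a distribution function on [0,∞) with F(x) = 0 for x ≤ 0 and 1 − F(t) = t^{−β} L(t) for t > 0, where 0 < β < 1 and L is a slowly varying function (i.e. L is measurable, positive, and L(xt)/L(x) → 1 as x → ∞ for every t > 0). Then log(x) · (∫_{[0,∞)} t e^{−2xt} dF(t))^{−1} → 0 as x → 0⁺. -/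
open MeasureTheory Filter Topology

/-- An antitone positive function with `G (2 s) / G s → 2 ^ (-β)` decays more slowly than
`s ^ (-γ)` for every `γ > β`. -/
lemma exists_rpow_le_of_tendsto_div {G : ℝ → ℝ} {β γ : ℝ} (hγ0 : 0 < γ) (hβγ : β < γ)
    (hG : Antitone G) (hpos : ∀ t, 0 < t → 0 < G t)
    (hlim : Tendsto (fun s => G (s * 2) / G s) atTop (𝓝 (2 ^ (-β)))) :
    ∃ c > 0, ∀ᶠ s in atTop, c * s ^ (-γ) ≤ G s := by
  have hlt : (2 : ℝ) ^ (-γ) < 2 ^ (-β) :=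
    Real.rpow_lt_rpow_of_exponent_lt one_lt_two (by linarith)
  obtain ⟨X, hX⟩ := eventually_atTop.1 ((hlim.eventually_const_lt hlt).and (eventually_gt_atTop 0))
  have hX0 : 0 < X := (hX X le_rfl).2
  have hstep : ∀ s, X ≤ s → (2 : ℝ) ^ (-γ) * G s ≤ G (s * 2) := fun s hs =>
    ((lt_div_iff₀ (hpos s (hX s hs).2)).1 (hX s hs).1).le
  have hpow : ∀ n : ℕ, ((2 : ℝ) ^ n) ^ (-γ) * G X ≤ G (X * 2 ^ n) := by
    intro n
    induction n with
    | zero => simp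
    | succ n ih =>
      have h1 : X ≤ X * 2 ^ n := le_mul_of_one_le_right hX0.le (one_le_pow₀ one_le_two)
      calc ((2 : ℝ) ^ (n + 1)) ^ (-γ) * G X
          = 2 ^ (-γ) * (((2 : ℝ) ^ n) ^ (-γ) * G X) := by
            rw [pow_succ, Real.mul_rpow (by positivity) (by positivity)]; ring
        _ ≤ 2 ^ (-γ) * G (X * 2 ^ n) := by gcongr
        _ ≤ G (X * 2 ^ n * 2) := hstep _ h1
        _ = G (X * 2 ^ (n + 1)) := by rw [pow_succ, mul_assoc]
  have hGX := hpos X hX0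
  refine ⟨2 ^ (-γ) * G X * (X⁻¹) ^ (-γ), by positivity, ?_⟩
  filter_upwards [eventually_ge_atTop X] with s hs
  have hs0 : 0 < s := hX0.trans_le hs
  obtain ⟨n, hn1, hn2⟩ := exists_nat_pow_near ((one_le_div hX0).2 hs) (one_lt_two (α := ℝ))
  have hle : s ≤ X * 2 ^ (n + 1) := by
    rw [div_lt_iff₀ hX0] at hn2; linarith
  calc 2 ^ (-γ) * G X * (X⁻¹) ^ (-γ) * s ^ (-γ)
      = 2 ^ (-γ) * (s / X) ^ (-γ) * G X := by
        rw [div_eq_mul_inv, Real.mul_rpow hs0.le (by positivity)]; ring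
    _ ≤ 2 ^ (-γ) * ((2 : ℝ) ^ n) ^ (-γ) * G X := by
        have := Real.rpow_le_rpow_of_nonpos (by positivity) hn1 (neg_nonpos.2 hγ0.le)
        gcongr
    _ = ((2 : ℝ) ^ (n + 1)) ^ (-γ) * G X := by
        rw [pow_succ, Real.mul_rpow (by positivity) (by positivity)]; ring
    _ ≤ G (X * 2 ^ (n + 1)) := hpow _
    _ ≤ G s := hG hle

lemma integrable_mul_exp_neg {μ : Measure ℝ} [IsFiniteMeasure μ] (hμ : ∀ᵐ t ∂μ, 0 ≤ t)
    {x : ℝ} (hx : 0 < x) : Integrable (fun t => t * Real.exp (-2 * x * t)) μ := by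
  refine Integrable.of_bound (by fun_prop) (1 / (2 * x)) ?_
  filter_upwards [hμ] with t ht
  rw [Real.norm_of_nonneg (by positivity), le_div_iff₀ (by positivity)]
  have h1 := Real.add_one_le_exp (2 * x * t)
  have h2 : Real.exp (-2 * x * t) * Real.exp (2 * x * t) = 1 := by
    rw [← Real.exp_add]; simp
  have h3 := Real.exp_pos (-2 * x * t)
  nlinarith

/-- Restricting `∫ t e^{-2xt} dμ` to the interval `(x⁻¹, 2x⁻¹]`. -/
lemma le_integral_mul_exp_neg {μ : Measure ℝ} [IsFiniteMeasure μ] (hμ : ∀ᵐ t ∂μ, 0 ≤ t)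
    {x : ℝ} (hx : 0 < x) :
    x⁻¹ * Real.exp (-4) * μ.real (Set.Ioc x⁻¹ (x⁻¹ * 2)) ≤
      ∫ t, t * Real.exp (-2 * x * t) ∂μ := by
  have hint := integrable_mul_exp_neg hμ hx
  calc x⁻¹ * Real.exp (-4) * μ.real (Set.Ioc x⁻¹ (x⁻¹ * 2))
      ≤ ∫ t in Set.Ioc x⁻¹ (x⁻¹ * 2), t * Real.exp (-2 * x * t) ∂μ := by
        refine setIntegral_ge_of_const_le_real measurableSet_Ioc (measure_ne_top _ _) ?_
          hint.integrableOn
        intro t ht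
        have hx' : x * x⁻¹ = 1 := mul_inv_cancel₀ hx.ne'
        have h1 : -4 ≤ -2 * x * t := by
          have := mul_le_mul_of_nonneg_left ht.2 hx.le
          nlinarith
        have := ht.1
        have h0 : 0 < x⁻¹ := by positivity
        have ht0 : 0 ≤ t := by linarith
        gcongr
    _ ≤ _ := setIntegral_le_integral hint (by
        filter_upwards [hμ] with t ht
        simp only [Pi.zero_apply]
        positivity)

/-- If `1 − F(t) = t^{−β} L(t)` with `0 < β < 1` and `L` slowly
varying, then condition (C2) holds:
`log(x) · (∫ t e^{−2xt} dF(t))⁻¹ → 0` as `x → 0⁺`.  Here `μ` is the Borel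
probability measure on `[0,∞)` with distribution function `F`. -/
theorem condition_C2_of_regular_variation
    (β : ℝ) (hβ0 : 0 < β) (hβ1 : β < 1)
    (μ : Measure ℝ) (hμprob : IsProbabilityMeasure μ)
    (hsupp : μ (Set.Iio (0 : ℝ)) = 0)
    (F L : ℝ → ℝ)
    (hFdef : ∀ x : ℝ, F x = (μ (Set.Iic x)).toReal)
    (hLmeas : Measurable L) (hLpos : ∀ t : ℝ, 0 < t → 0 < L t)
    (hLslow : ∀ t : ℝ, 0 < t →
      Tendsto (fun x : ℝ => L (x * t) / L x) atTop (𝓝 1))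
    (hF : ∀ t : ℝ, 0 < t → 1 - F t = t ^ (-β) * L t) :
    Tendsto (fun x : ℝ =>
        Real.log x * (∫ t, t * Real.exp (-2 * x * t) ∂μ)⁻¹)
      (nhdsWithin 0 (Set.Ioi 0)) (𝓝 0) := by
  have hnonneg : ∀ᵐ t ∂μ, 0 ≤ t := by
    rw [ae_iff]; simp only [not_le]; exact hsupp
  set G : ℝ → ℝ := fun t => 1 - F t with hGdef
  have hFmono : Monotone F := fun a b hab => by
    rw [hFdef, hFdef]
    exact measureReal_mono (Set.Iic_subset_Iic.2 hab)
  have hG : Antitone G := fun a b hab => sub_le_sub_left (hFmono hab) 1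
  have hGpos : ∀ t, 0 < t → 0 < G t := fun t ht => by
    have := hLpos t ht
    simp only [hGdef, hF t ht]
    positivity
  have hlim : Tendsto (fun s => G (s * 2) / G s) atTop (𝓝 (2 ^ (-β))) := by
    have := (hLslow 2 two_pos).const_mul ((2 : ℝ) ^ (-β))
    rw [mul_one] at this
    refine this.congr' ?_
    filter_upwards [eventually_gt_atTop 0] with s hs
    have hL := hLpos s hs
    have hsβ : 0 < s ^ (-β) := by positivity
    simp only [hGdef, hF s hs, hF (s * 2) (by positivity)]
    rw [Real.mul_rpow hs.le (by positivity)]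
    field_simp
  obtain ⟨γ, hβγ, hγ1⟩ := exists_between hβ1
  obtain ⟨c, hc, hcG⟩ := exists_rpow_le_of_tendsto_div (hβ0.trans hβγ) hβγ hG hGpos hlim
  obtain ⟨r, hβr, hr1⟩ := exists_between
    (Real.rpow_lt_one_of_one_lt_of_neg one_lt_two (neg_lt_zero.2 hβ0))
  have hr := hlim.eventually_lt_const hβr
  have hIoc : ∀ s, 0 < s → μ.real (Set.Ioc s (s * 2)) = G s - G (s * 2) := fun s hs => by
    have hsub : Set.Iic s ⊆ Set.Iic (s * 2) := Set.Iic_subset_Iic.2 (by linarith)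
    rw [← Set.Iic_sdiff_Iic, measureReal_sdiff hsub measurableSet_Iic]
    simp only [hGdef, hFdef, Measure.real]
    ring
  set K : ℝ := Real.exp (-4) * ((1 - r) * c) with hK
  have hK0 : 0 < K := mul_pos (Real.exp_pos _) (mul_pos (sub_pos.2 hr1) hc)
  have hlower : ∀ᶠ x in 𝓝[>] (0 : ℝ),
      K * x ^ (γ - 1) ≤ ∫ t, t * Real.exp (-2 * x * t) ∂μ := by
    filter_upwards [tendsto_inv_nhdsGT_zero.eventually hcG,
      tendsto_inv_nhdsGT_zero.eventually hr, self_mem_nhdsWithin] with x h1 h2 hx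
    have hx : 0 < x := hx
    have hs : 0 < x⁻¹ := by positivity
    refine le_trans ?_ (le_integral_mul_exp_neg hnonneg hx)
    rw [hIoc _ hs]
    rw [div_lt_iff₀ (hGpos _ hs)] at h2
    rw [Real.inv_rpow hx.le, Real.rpow_neg hx.le, inv_inv] at h1
    have h3 : (1 - r) * (c * x ^ γ) ≤ G x⁻¹ - G (x⁻¹ * 2) := by nlinarith
    calc K * x ^ (γ - 1) = x⁻¹ * Real.exp (-4) * ((1 - r) * (c * x ^ γ)) := by
          rw [Real.rpow_sub_one hx.ne', hK]; ring
      _ ≤ _ := by gcongr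
  have hzero : Tendsto (fun x : ℝ => K⁻¹ * |Real.log x * x ^ (1 - γ)|) (𝓝[>] 0) (𝓝 0) := by
    simpa using (tendsto_log_mul_rpow_nhdsGT_zero (sub_pos.2 hγ1)).abs.const_mul K⁻¹
  refine squeeze_zero_norm' ?_ hzero
  filter_upwards [hlower, self_mem_nhdsWithin] with x h1 hx
  have hx : 0 < x := hx
  have hpos : 0 < K * x ^ (γ - 1) := by positivity
  rw [norm_mul, norm_inv, Real.norm_of_nonneg (hpos.le.trans h1), Real.norm_eq_abs, abs_mul,
    abs_of_pos (Real.rpow_pos_of_pos hx (1 - γ))]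
  calc |Real.log x| * (∫ t, t * Real.exp (-2 * x * t) ∂μ)⁻¹
      ≤ |Real.log x| * (K * x ^ (γ - 1))⁻¹ := by gcongr
    _ = K⁻¹ * (|Real.log x| * x ^ (1 - γ)) := by
        rw [mul_inv, ← Real.rpow_neg hx.le, neg_sub]; ring
end

section
/- Fix α > 0 and β > 1 and, for n > α, let π_n be the probability measure on [0,1] with density proportional to θ^{−β} 1_{(α/n,1]}(θ). Let S_{n,j} have law P{S_{n,j}=k} = C(n,k)∫_{[0,1]} θ^k(1−θ)^{n−k} π_n(dθ) and let Z_{m,j} have the Binomial(m, μ_n) law with μ_n := ∫_{[0,1]} θ π_n(dθ). Then: (i) for every k ≥ 0, lim_{n→∞} P{S_{n,j}=k} = p_{α,β}(k) := (α^{β−1}(β−1)/k!)∫_α^∞ t^{k−β}e^{−t}dt; (ii) if β > 2 and m_n = ⌊δn⌋ with δ ∈ (0,1], then Z_{m_n,j} converges in distribution to Poisson(δα(β−1)/(β−2)); (iii) if β = 2 and m_n = ⌊δn/log n⌋, then Z_{m_n,j} converges in distribution to Poisson(δα); (iv) if 1 < β < 2 and m_n = ⌊δ n^{β−1}⌋,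 then Z_{m_n,j} converges in distribution to Poisson(δα^{β−1}(β−1)/(2−β)). -/
open MeasureTheory Filter Topology

lemma tendsto_zero_of_tendsto_natCast_mul {ι : Type*} {l : Filter ι} {m : ι → ℕ} {q : ι → ℝ}
    {t : ℝ} (hm : Tendsto m l atTop) (hq : Tendsto (fun i => m i * q i) l (𝓝 t)) :
    Tendsto q l (𝓝 0) := by
  refine (hq.div_atTop (tendsto_natCast_atTop_atTop.comp hm)).congr' ?_
  filter_upwards [hm.eventually_ge_atTop 1] with i hi
  have : (m i : ℝ) ≠ 0 := by positivity
  simp only [Function.comp_apply]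
  field_simp

lemma tendsto_one_add_pow_exp_of_tendsto_mul {ι : Type*} {l : Filter ι} {m : ι → ℕ} {q : ι → ℝ}
    {t : ℝ} (hm : Tendsto m l atTop) (hq : Tendsto (fun i => m i * q i) l (𝓝 t)) :
    Tendsto (fun i => (1 + q i) ^ m i) l (𝓝 (Real.exp t)) := by
  have hq0 : Tendsto q l (𝓝 0) := tendsto_zero_of_tendsto_natCast_mul hm hq
  have h1 : Tendsto (fun i => 1 + q i) l (𝓝 1) := by simpa using hq0.const_add 1
  have hpos : ∀ᶠ i in l, 0 < 1 + q i := h1.eventually (Ioi_mem_nhds one_pos)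
  have hlog : Tendsto (fun i => m i * Real.log (1 + q i)) l (𝓝 t) := by
    have hlow : Tendsto (fun i => m i * q i / (1 + q i)) l (𝓝 t) := by
      have h := hq.div h1 one_ne_zero
      rwa [div_one] at h
    refine tendsto_of_tendsto_of_tendsto_of_le_of_le' hlow hq ?_ ?_
    · filter_upwards [hpos] with i hi
      rw [mul_div_assoc]
      refine mul_le_mul_of_nonneg_left ?_ (Nat.cast_nonneg _)
      have := Real.one_sub_inv_le_log_of_pos hi
      have e : q i / (1 + q i) = 1 - (1 + q i)⁻¹ := by field_simp; ring
      rwa [e]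
    · filter_upwards [hpos] with i hi
      refine mul_le_mul_of_nonneg_left ?_ (Nat.cast_nonneg _)
      have := Real.log_le_sub_one_of_pos hi
      linarith
  refine ((Real.continuous_exp.tendsto t).comp hlog).congr' ?_
  filter_upwards [hpos] with i hi
  rw [Function.comp_apply, Real.exp_nat_mul, Real.exp_log hi]

/-- Poisson limit theorem for binomial laws whose number of trials is an arbitrary sequence
tending to infinity. -/
lemma tendsto_choose_mul_pow_poisson {ι : Type*} {l : Filter ι} {m : ι → ℕ} {q : ι → ℝ} {r : ℝ}
    (hm : Tendsto m l atTop) (hq : Tendsto (fun i => m i * q i) l (𝓝 r)) (k : ℕ) :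
    Tendsto (fun i => ((m i).choose k : ℝ) * q i ^ k * (1 - q i) ^ (m i - k)) l
      (𝓝 (Real.exp (-r) * r ^ k / (k.factorial : ℝ))) := by
  have hq0 : Tendsto q l (𝓝 0) := tendsto_zero_of_tendsto_natCast_mul hm hq
  have h1 : Tendsto (fun i => 1 - q i) l (𝓝 1) := by simpa using hq0.const_sub 1
  have hpos : ∀ᶠ i in l, 0 < 1 - q i := h1.eventually (Ioi_mem_nhds one_pos)
  have hchoose : Tendsto (fun i => ((m i).choose k : ℝ) * q i ^ k) l
      (𝓝 (r ^ k / (k.factorial : ℝ))) := by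
    have e := ((isEquivalent_choose k).comp_tendsto hm).mul
      (Asymptotics.IsEquivalent.refl (u := fun i => q i ^ k) (l := l))
    refine (Asymptotics.IsEquivalent.tendsto_nhds_iff e).mpr ?_
    refine ((hq.pow k).div_const _).congr fun i => ?_
    simp only [Pi.mul_apply, Function.comp_apply]
    rw [mul_pow]; ring
  have hexp : Tendsto (fun i => (1 - q i) ^ m i) l (𝓝 (Real.exp (-r))) := by
    simpa [sub_eq_add_neg] using tendsto_one_add_pow_exp_of_tendsto_mul (q := fun i => -q i) hm
      (by simpa using hq.neg)
  have h := hchoose.mul (hexp.div (h1.pow k) (by simp))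
  have e : r ^ k / (k.factorial : ℝ) * (Real.exp (-r) / 1 ^ k) =
      Real.exp (-r) * r ^ k / (k.factorial : ℝ) := by rw [one_pow]; ring
  rw [e] at h
  refine h.congr' ?_
  filter_upwards [hpos, hm.eventually_ge_atTop k] with i hi hk
  rw [Pi.div_apply, pow_sub₀ _ hi.ne' hk, div_eq_mul_inv]

lemma tendsto_choose_floor_mul_pow_poisson {a μ : ℕ → ℝ} {δ c : ℝ} (hδ : 0 < δ)
    (ha : Tendsto a atTop atTop) (haμ : Tendsto (fun n => a n * μ n) atTop (𝓝 c)) (k : ℕ) :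
    Tendsto (fun n => ((⌊δ * a n⌋₊).choose k : ℝ) * μ n ^ k * (1 - μ n) ^ (⌊δ * a n⌋₊ - k)) atTop
      (𝓝 (Real.exp (-(δ * c)) * (δ * c) ^ k / (k.factorial : ℝ))) := by
  have hx : Tendsto (fun n => δ * a n) atTop atTop := ha.const_mul_atTop hδ
  refine tendsto_choose_mul_pow_poisson (tendsto_nat_floor_atTop.comp hx) ?_ k
  have h := (tendsto_nat_floor_div_atTop (R := ℝ)).comp hx |>.mul (haμ.const_mul δ)
  rw [one_mul] at h
  refine h.congr' ?_
  filter_upwards [hx.eventually_gt_atTop 0] with n hn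
  simp only [Function.comp_apply]
  rw [← mul_assoc, ← mul_assoc, mul_assoc _ δ (a n), div_mul_cancel₀ _ hn.ne']

lemma tendsto_rpow_mul_normalizer_inv {α β : ℝ} (hα : 0 < α) (hβ : 1 < β) :
    Tendsto (fun n : ℕ => (n : ℝ) ^ (β - 1) * ((((n : ℝ) / α) ^ (β - 1) - 1) / (β - 1))⁻¹) atTop
      (𝓝 (α ^ (β - 1) * (β - 1))) := by
  have hb : 0 < β - 1 := by linarith
  have h0 : Tendsto (fun n : ℕ => (n : ℝ) ^ (-(β - 1))) atTop (𝓝 0) :=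
    (tendsto_rpow_neg_atTop hb).comp tendsto_natCast_atTop_atTop
  have hαp : 0 < α ^ (β - 1) := Real.rpow_pos_of_pos hα _
  have h : Tendsto (fun n : ℕ => (β - 1) / ((α ^ (β - 1))⁻¹ - (n : ℝ) ^ (-(β - 1)))) atTop
      (𝓝 ((β - 1) / ((α ^ (β - 1))⁻¹ - 0))) :=
    tendsto_const_nhds.div (tendsto_const_nhds.sub h0) (by simpa using hαp.ne')
  have e : (β - 1) / ((α ^ (β - 1))⁻¹ - 0) = α ^ (β - 1) * (β - 1) := by
    rw [sub_zero, div_inv_eq_mul, mul_comm]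
  rw [e] at h
  refine h.congr' ?_
  filter_upwards [eventually_gt_atTop 0] with n hn
  have hn' : (0 : ℝ) < n := by exact_mod_cast hn
  have hp : 0 < (n : ℝ) ^ (β - 1) := Real.rpow_pos_of_pos hn' _
  rw [Real.div_rpow hn'.le hα.le, Real.rpow_neg hn'.le, inv_div, mul_div_assoc', mul_comm _ (β - 1)]
  have e2 : (n : ℝ) ^ (β - 1) / α ^ (β - 1) - 1 =
      (n : ℝ) ^ (β - 1) * ((α ^ (β - 1))⁻¹ - ((n : ℝ) ^ (β - 1))⁻¹) := by
    rw [mul_sub, mul_inv_cancel₀ hp.ne', div_eq_mul_inv]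
  rw [e2, mul_comm (β - 1), mul_div_mul_left _ _ hp.ne']

lemma setIntegral_Ioc_rpow_neg_mul_self {a β : ℝ} (ha : 0 < a) (ha1 : a ≤ 1) (hβ : β ≠ 2) :
    ∫ θ in Set.Ioc a 1, θ ^ (-β) * θ = (1 - a ^ (2 - β)) / (2 - β) := by
  have h : ∫ θ in Set.Ioc a 1, θ ^ (-β) * θ = ∫ θ in Set.Ioc a 1, θ ^ (1 - β) := by
    refine setIntegral_congr_fun measurableSet_Ioc fun θ hθ => ?_
    have hθ0 : 0 < θ := ha.trans hθ.1
    rw [sub_eq_neg_add, Real.rpow_add_one hθ0.ne']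
  rw [h, ← intervalIntegral.integral_of_le ha1, integral_rpow]
  · rw [Real.one_rpow]
    ring_nf
  · right
    refine ⟨fun h => hβ (by linarith), ?_⟩
    rw [Set.uIcc_of_le ha1]
    exact fun h => absurd h.1 (not_le.mpr ha)

lemma setIntegral_Ioc_rpow_neg_two_mul_self {a : ℝ} (ha : 0 < a) (ha1 : a ≤ 1) :
    ∫ θ in Set.Ioc a 1, θ ^ (-2 : ℝ) * θ = -Real.log a := by
  have h : ∫ θ in Set.Ioc a 1, θ ^ (-2 : ℝ) * θ = ∫ θ in Set.Ioc a 1, θ⁻¹ := by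
    refine setIntegral_congr_fun measurableSet_Ioc fun θ hθ => ?_
    have hθ0 : 0 < θ := ha.trans hθ.1
    rw [← Real.rpow_add_one hθ0.ne', ← Real.rpow_neg_one]
    norm_num
  rw [h, ← intervalIntegral.integral_of_le ha1, integral_inv_of_pos ha one_pos, one_div,
    Real.log_inv]

/-- The substitution `θ = t / n`, expressed with an indicator so that the domain of integration
does not depend on `n`. -/
lemma setIntegral_Ioc_div_eq_setIntegral_Ioi {α : ℝ} {n : ℕ} (hn : 0 < n)
    (hαn : α ≤ n) (f : ℝ → ℝ) :
    ∫ θ in Set.Ioc (α / n) 1, f θ =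
      (n : ℝ)⁻¹ * ∫ t in Set.Ioi α, (Set.Iic (n : ℝ)).indicator (fun t => f (t / n)) t := by
  have hn' : (0 : ℝ) < n := by exact_mod_cast hn
  rw [setIntegral_indicator measurableSet_Iic, Set.Ioi_inter_Iic,
    ← intervalIntegral.integral_of_le hαn, intervalIntegral.inv_mul_integral_comp_div,
    div_self hn'.ne', intervalIntegral.integral_of_le]
  rwa [div_le_one hn']

lemma choose_mul_pow_mul_pow_le_one {n k : ℕ} {x : ℝ} (h0 : 0 ≤ x) (h1 : x ≤ 1) :
    (n.choose k : ℝ) * x ^ k * (1 - x) ^ (n - k) ≤ 1 := by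
  have hx : 0 ≤ 1 - x := sub_nonneg.mpr h1
  rcases lt_or_ge n k with h | h
  · simp [Nat.choose_eq_zero_of_lt h]
  · have hs := add_pow x (1 - x) n
    rw [add_sub_cancel, one_pow] at hs
    refine le_of_le_of_eq ?_ hs.symm
    refine le_trans (le_of_eq ?_) (Finset.single_le_sum
      (f := fun m => x ^ m * (1 - x) ^ (n - m) * (n.choose m : ℝ))
      (fun i _ => by positivity) (Finset.mem_range.mpr (Nat.lt_succ_of_le h)))
    ring

lemma tendsto_setIntegral_rpow_mul_binomial {α β : ℝ} (hα : 0 < α) (hβ : 1 < β) (k : ℕ) :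
    Tendsto (fun n : ℕ => ∫ t in Set.Ioi α, (Set.Iic (n : ℝ)).indicator
        (fun t => t ^ (-β) * ((n.choose k : ℝ) * (t / n) ^ k * (1 - t / n) ^ (n - k))) t) atTop
      (𝓝 ((k.factorial : ℝ)⁻¹ * ∫ t in Set.Ioi α, t ^ ((k : ℝ) - β) * Real.exp (-t))) := by
  rw [← integral_const_mul]
  refine tendsto_integral_of_dominated_convergence (fun t => t ^ (-β)) (fun n => ?_)
    (integrableOn_Ioi_rpow_of_lt (by linarith) hα) (fun n => ?_) ?_
  · refine (Measurable.indicator ?_ measurableSet_Iic).aestronglyMeasurable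
    fun_prop
  · filter_upwards [ae_restrict_mem measurableSet_Ioi] with t ht
    have ht0 : 0 < t := hα.trans ht
    have hp : 0 ≤ t ^ (-β) := Real.rpow_nonneg ht0.le _
    by_cases htn : t ∈ Set.Iic (n : ℝ)
    · have hn : (0 : ℝ) < n := ht0.trans_le htn
      have h0 : 0 ≤ t / n := by positivity
      have h1 : t / n ≤ 1 := (div_le_one hn).mpr htn
      have h2 : 0 ≤ 1 - t / n := sub_nonneg.mpr h1
      rw [Set.indicator_of_mem htn, Real.norm_of_nonneg (by positivity)]
      exact mul_le_of_le_one_right hp (choose_mul_pow_mul_pow_le_one h0 h1)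
    · rw [Set.indicator_of_notMem htn, norm_zero]
      exact hp
  · filter_upwards [ae_restrict_mem measurableSet_Ioi] with t ht
    have ht0 : 0 < t := hα.trans ht
    have hlim : Tendsto (fun n : ℕ => (n : ℝ) * (t / n)) atTop (𝓝 t) := by
      refine tendsto_const_nhds.congr' ?_
      filter_upwards [eventually_gt_atTop 0] with n hn
      have : (n : ℝ) ≠ 0 := by positivity
      field_simp
    have h := (tendsto_choose_mul_pow_poisson tendsto_id hlim k).const_mul (t ^ (-β))
    have e : t ^ (-β) * (Real.exp (-t) * t ^ k / (k.factorial : ℝ)) =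
        (k.factorial : ℝ)⁻¹ * (t ^ ((k : ℝ) - β) * Real.exp (-t)) := by
      rw [sub_eq_neg_add, Real.rpow_add_natCast ht0.ne']
      ring
    rw [e] at h
    refine h.congr' ?_
    filter_upwards [tendsto_natCast_atTop_atTop.eventually_ge_atTop t] with n hn
    rw [Set.indicator_of_mem (Set.mem_Iic.mpr hn)]
    rfl

/-- Degree distributions of the two-parameter model with mixing
density `Z_n⁻¹ θ^{−β} 1_{(α/n,1]}(θ)`: the out-degree distribution converges
pointwise to `p_{α,β}`, and the Binomial(`m_n`, `μ_n`) in-degree distribution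
converges pointwise to a Poisson law, with the appropriate scaling of `m_n` in
each of the three regimes `β > 2`, `β = 2`, `1 < β < 2`. -/
theorem two_parameter_degree_distributions
    (α β : ℝ) (hα : 0 < α) (hβ : 1 < β)
    (Z : ℕ → ℝ) (hZ : ∀ n : ℕ, Z n = (((n : ℝ) / α) ^ (β - 1) - 1) / (β - 1))
    (PS : ℕ → ℕ → ℝ)
    (hPS : ∀ n k : ℕ, PS n k = (n.choose k : ℝ) *
      ∫ θ in Set.Ioc (α / n) 1, (Z n)⁻¹ * θ ^ (-β) * θ ^ k * (1 - θ) ^ (n - k))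
    (μn : ℕ → ℝ)
    (hμn : ∀ n : ℕ, μn n = ∫ θ in Set.Ioc (α / n) 1, (Z n)⁻¹ * θ ^ (-β) * θ)
    (p : ℕ → ℝ)
    (hp : ∀ k : ℕ, p k = α ^ (β - 1) * (β - 1) / (k.factorial : ℝ) *
      ∫ t in Set.Ioi α, t ^ ((k : ℝ) - β) * Real.exp (-t)) :
    (∀ k : ℕ, Tendsto (fun n : ℕ => PS n k) atTop (𝓝 (p k))) ∧
    (2 < β → ∀ δ : ℝ, δ ∈ Set.Ioc (0 : ℝ) 1 → ∀ k : ℕ,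
      Tendsto (fun n : ℕ =>
          ((⌊δ * (n : ℝ)⌋₊).choose k : ℝ) * (μn n) ^ k * (1 - μn n) ^ (⌊δ * (n : ℝ)⌋₊ - k))
        atTop (𝓝 (Real.exp (-(δ * α * (β - 1) / (β - 2))) *
          (δ * α * (β - 1) / (β - 2)) ^ k / (k.factorial : ℝ)))) ∧
    (β = 2 → ∀ δ : ℝ, δ ∈ Set.Ioc (0 : ℝ) 1 → ∀ k : ℕ,
      Tendsto (fun n : ℕ =>
          ((⌊δ * (n : ℝ) / Real.log n⌋₊).choose k : ℝ) * (μn n) ^ k *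
            (1 - μn n) ^ (⌊δ * (n : ℝ) / Real.log n⌋₊ - k))
        atTop (𝓝 (Real.exp (-(δ * α)) * (δ * α) ^ k / (k.factorial : ℝ)))) ∧
    (β < 2 → ∀ δ : ℝ, δ ∈ Set.Ioc (0 : ℝ) 1 → ∀ k : ℕ,
      Tendsto (fun n : ℕ =>
          ((⌊δ * (n : ℝ) ^ (β - 1)⌋₊).choose k : ℝ) * (μn n) ^ k *
            (1 - μn n) ^ (⌊δ * (n : ℝ) ^ (β - 1)⌋₊ - k))
        atTop (𝓝 (Real.exp (-(δ * α ^ (β - 1) * (β - 1) / (2 - β))) *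
          (δ * α ^ (β - 1) * (β - 1) / (2 - β)) ^ k / (k.factorial : ℝ)))) := by
  obtain rfl : Z = fun n : ℕ => (((n : ℝ) / α) ^ (β - 1) - 1) / (β - 1) := funext hZ
  have hnorm := tendsto_rpow_mul_normalizer_inv hα hβ
  have hμ : ∀ n : ℕ, μn n = ((((n : ℝ) / α) ^ (β - 1) - 1) / (β - 1))⁻¹ *
      ∫ θ in Set.Ioc (α / n) 1, θ ^ (-β) * θ := fun n => by
    simp only [hμn, mul_assoc, integral_const_mul]
  have hmean : ∀ {a : ℕ → ℝ} {c : ℝ}, Tendsto (fun n : ℕ => a n / (n : ℝ) ^ (β - 1) *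
      ∫ θ in Set.Ioc (α / n) 1, θ ^ (-β) * θ) atTop (𝓝 c) →
      Tendsto (fun n => a n * μn n) atTop (𝓝 (α ^ (β - 1) * (β - 1) * c)) := by
    intro a c h
    refine (hnorm.mul h).congr' ?_
    filter_upwards [eventually_gt_atTop 0] with n hn
    have : (n : ℝ) ^ (β - 1) ≠ 0 := (Real.rpow_pos_of_pos (by exact_mod_cast hn) _).ne'
    rw [hμ]
    generalize (((n : ℝ) / α) ^ (β - 1) - 1) / (β - 1) = z
    field_simp
  have hscale : ∀ᶠ n : ℕ in atTop, 0 < (n : ℝ) ∧ 0 < α / n ∧ α / n ≤ 1 := by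
    filter_upwards [tendsto_natCast_atTop_atTop.eventually_ge_atTop α] with n hn
    have hn0 : (0 : ℝ) < n := hα.trans_le hn
    exact ⟨hn0, by positivity, (div_le_one hn0).mpr hn⟩
  refine ⟨fun k => ?_, fun hβ2 δ hδ k => ?_, fun hβ2 δ hδ k => ?_, fun hβ2 δ hδ k => ?_⟩
  · have h := hnorm.mul (tendsto_setIntegral_rpow_mul_binomial hα hβ k)
    rw [← mul_assoc, ← div_eq_mul_inv, ← hp] at h
    refine h.congr' ?_
    filter_upwards [hscale] with n ⟨hn, _, hn1⟩
    have hαn : α ≤ n := (div_le_one hn).mp hn1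
    rw [hPS, setIntegral_Ioc_div_eq_setIntegral_Ioi (by exact_mod_cast hn) hαn,
      ← integral_const_mul, ← integral_const_mul, ← integral_const_mul]
    refine setIntegral_congr_fun measurableSet_Ioi fun t ht => ?_
    have ht0 : 0 < t := hα.trans ht
    by_cases htn : t ∈ Set.Iic (n : ℝ)
    · simp only [Set.indicator_of_mem htn]
      rw [Real.div_rpow ht0.le hn.le, Real.rpow_neg hn.le, div_inv_eq_mul,
        Real.rpow_sub_one hn.ne']
      ring
    · simp only [Set.indicator_of_notMem htn, mul_zero]
  · have h0 : Tendsto (fun n : ℕ => (n : ℝ) ^ (-(β - 2))) atTop (𝓝 0) :=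
      (tendsto_rpow_neg_atTop (by linarith)).comp tendsto_natCast_atTop_atTop
    have h : Tendsto (fun n : ℕ => (n : ℝ) * μn n) atTop
        (𝓝 (α ^ (β - 1) * (β - 1) * ((0 - α ^ (2 - β)) / (2 - β)))) := by
      refine hmean (((h0.sub_const _).div_const _).congr' ?_)
      filter_upwards [hscale] with n ⟨hn, ha, ha1⟩
      rw [setIntegral_Ioc_rpow_neg_mul_self ha ha1 hβ2.ne', Real.div_rpow hα.le hn.le]
      have e : (n : ℝ) / (n : ℝ) ^ (β - 1) = (n : ℝ) ^ (2 - β) := by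
        rw [← Real.rpow_one_sub' hn.le (by linarith)]
        ring_nf
      have hne : (n : ℝ) ^ (2 - β) ≠ 0 := (Real.rpow_pos_of_pos hn _).ne'
      rw [e, neg_sub, mul_div_assoc', mul_sub, mul_one, mul_div_cancel₀ _ hne]
    have e : δ * (α ^ (β - 1) * (β - 1) * ((0 - α ^ (2 - β)) / (2 - β))) =
        δ * α * (β - 1) / (β - 2) := by
      have e1 : α ^ (β - 1) * α ^ (2 - β) = α := by
        rw [← Real.rpow_add hα]; norm_num
      have e2 : (0 - α ^ (2 - β)) / (2 - β) = α ^ (2 - β) / (β - 2) := by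
        rw [zero_sub, ← neg_sub β 2, neg_div_neg_eq]
      rw [e2]
      linear_combination δ * (β - 1) / (β - 2) * e1
    rw [← e]
    exact tendsto_choose_floor_mul_pow_poisson hδ.1 tendsto_natCast_atTop_atTop h k
  · subst hβ2
    have hlog : Tendsto (fun n : ℕ => Real.log n) atTop atTop :=
      Real.tendsto_log_atTop.comp tendsto_natCast_atTop_atTop
    have ha : Tendsto (fun n : ℕ => (n : ℝ) / Real.log n) atTop atTop := by
      have h := (Real.isLittleO_log_id_atTop.tendsto_div_nhds_zero).comp
        (tendsto_natCast_atTop_atTop (R := ℝ))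
      have h' : Tendsto (fun n : ℕ => Real.log n / (n : ℝ)) atTop (𝓝[>] 0) := by
        refine tendsto_nhdsWithin_iff.mpr ⟨h, ?_⟩
        filter_upwards [hscale, hlog.eventually_gt_atTop 0] with n ⟨hn, _⟩ hl
        exact div_pos hl hn
      exact h'.inv_tendsto_nhdsGT_zero.congr fun n => by simp
    have h : Tendsto (fun n : ℕ => (n : ℝ) / Real.log n * μn n) atTop
        (𝓝 (α ^ ((2 : ℝ) - 1) * (2 - 1) * (1 - 0))) := by
      refine hmean (Tendsto.congr' ?_ ((hlog.const_div_atTop (Real.log α)).const_sub 1))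
      filter_upwards [hscale, hlog.eventually_gt_atTop 0] with n ⟨hn, ha, ha1⟩ hl
      rw [setIntegral_Ioc_rpow_neg_two_mul_self ha ha1, Real.log_div hα.ne' hn.ne']
      norm_num
      field_simp
    have e : α ^ ((2 : ℝ) - 1) * (2 - 1) * (1 - 0) = α := by norm_num
    rw [e] at h
    simpa only [mul_div_assoc] using tendsto_choose_floor_mul_pow_poisson hδ.1 ha h k
  · have ha : Tendsto (fun n : ℕ => (n : ℝ) ^ (β - 1)) atTop atTop :=
      (tendsto_rpow_atTop (by linarith)).comp tendsto_natCast_atTop_atTop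
    have h0 : Tendsto (fun n : ℕ => (α / n) ^ (2 - β)) atTop (𝓝 0) := by
      have := (tendsto_const_div_atTop_nhds_zero_nat α).rpow_const (p := 2 - β)
        (Or.inr (by linarith))
      rwa [Real.zero_rpow (by linarith)] at this
    have h : Tendsto (fun n : ℕ => (n : ℝ) ^ (β - 1) * μn n) atTop
        (𝓝 (α ^ (β - 1) * (β - 1) * ((1 - 0) / (2 - β)))) := by
      refine hmean (((h0.const_sub 1).div_const _).congr' ?_)
      filter_upwards [hscale] with n ⟨hn, ha, ha1⟩
      rw [setIntegral_Ioc_rpow_neg_mul_self ha ha1 hβ2.ne,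
        div_self (Real.rpow_pos_of_pos hn _).ne', one_mul]
    have e : δ * (α ^ (β - 1) * (β - 1) * ((1 - 0) / (2 - β))) =
        δ * α ^ (β - 1) * (β - 1) / (2 - β) := by ring
    rw [← e]
    exact tendsto_choose_floor_mul_pow_poisson hδ.1 ha h k
end
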